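/- Let Σ be a surface in a Bianchi–Cartan–Vranceanu space M³_{m,l} whose unit normal ξ = bE₁ − aE₂ (a² + b² = 1) is everywhere orthogonal to E₃, with adapted orthonormal frame e₁ = aE₁ + bE₂, e₂ = E₃. Then the second fundamental form satisfies h(e₁,e₁) = −(a e₁(b) − b e₁(a) + 2m(ay − bx)), h(e₁,e₂) = l/2, h(e₂,e₂) = 0, and e₂(a) = e₂(b) = 0; consequently Σ is a Hopf cylinder over a curve of geodesic curvature κ_g = −(a e₁(b) − b e₁(a) + 2m(ay − bx)) in (ℝ², h = (dx²+dy²)/[1+m(x²+y²)]²), with |A|² = κ_g² + l²/2 and mean curvature H = κ_g/2. -/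

import Mathlib

/-!
Coordinate-based Riemannian geometry on charts `ℝⁿ`, enough to express mean
curvature, second fundamental forms, curvature tensors and the (bi)tension
fields of isometric immersions, as used in
"Constant mean curvature and totally umbilical biharmonic surfaces in
3-dimensional geometries".
-/

noncomputable section

open scoped BigOperators

/-- A point of the coordinate chart `ℝⁿ`. -/
abbrev Pt (n : ℕ) := Fin n → ℝ

/-- A Riemannian metric on (an open part of) `ℝⁿ`, given by its coordinate matrix. -/
abbrev Met (n : ℕ) := Pt n → Matrix (Fin n) (Fin n) ℝ

/-- A vector field on `ℝⁿ`, in coordinates. -/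
abbrev VF (n : ℕ) := Pt n → Pt n

/-- The inner product of tangent vectors `v`, `w` at the point `p`, w.r.t. `g`. -/
def gip {n : ℕ} (g : Met n) (p v w : Pt n) : ℝ := ∑ i, ∑ j, g p i j * v i * w j

/-- `g` is a Riemannian metric: smooth, symmetric and positive definite. -/
structure IsRiemannian {n : ℕ} (g : Met n) : Prop where
  smooth : ∀ i j, ContDiff ℝ (⊤ : ℕ∞) fun p => g p i j
  symm : ∀ p i j, g p i j = g p j i
  posdef : ∀ p v, v ≠ 0 → 0 < gip g p v v

/-- Christoffel symbols `Γ^k_{ij}` of the Levi-Civita connection of `g`. -/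
def christoffel {n : ℕ} (g : Met n) (p : Pt n) (k i j : Fin n) : ℝ :=
  (1 / 2) * ∑ l, (g p)⁻¹ k l *
    (fderiv ℝ (fun q => g q j l) p (Pi.single i 1)
      + fderiv ℝ (fun q => g q i l) p (Pi.single j 1)
      - fderiv ℝ (fun q => g q i j) p (Pi.single l 1))

/-- The Levi-Civita covariant derivative `∇_X Y` of vector fields, in coordinates. -/
def cov {n : ℕ} (g : Met n) (X Y : VF n) : VF n := fun p k =>
  fderiv ℝ (fun q => Y q k) p (X p) + ∑ i, ∑ j, christoffel g p k i j * X p i * Y p j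

/-- The Lie bracket `[X, Y]` of vector fields. -/
def lieB {n : ℕ} (X Y : VF n) : VF n := fun p k =>
  fderiv ℝ (fun q => Y q k) p (X p) - fderiv ℝ (fun q => X q k) p (Y p)

/-- The curvature operator `R(X,Y)Z = ∇_X ∇_Y Z − ∇_Y ∇_X Z − ∇_{[X,Y]} Z`. -/
def curvOp {n : ℕ} (g : Met n) (X Y Z : VF n) : VF n := fun p =>
  cov g X (cov g Y Z) p - cov g Y (cov g X Z) p - cov g (lieB X Y) Z p

/-- The curvature tensor evaluated on tangent vectors at `p` (via constant extensions). -/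
def curvPt {n : ℕ} (g : Met n) (p v w z : Pt n) : Pt n :=
  curvOp g (fun _ => v) (fun _ => w) (fun _ => z) p

/-- The Ricci curvature `Ric(v, w) = trace (z ↦ R(z, v) w)` at `p`; for the Levi-Civita
connection of a Riemannian metric this agrees with `Σᵢ ⟨R(v, eᵢ) eᵢ, w⟩` for any
orthonormal frame `{eᵢ}`. -/
def ricci {n : ℕ} (g : Met n) (p v w : Pt n) : ℝ :=
  ∑ k, curvPt g p (Pi.single k 1) v w k

/-- The differential of `φ` at `u`, applied to the `a`-th coordinate direction. -/
def dmap {m n : ℕ} (φ : Pt m → Pt n) (u : Pt m) (a : Fin m) : Pt n := fun k =>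
  fderiv ℝ (fun q => φ q k) u (Pi.single a 1)

/-- The pushforward `dφ_u(v)` of a tangent vector of the domain. -/
def push {m n : ℕ} (φ : Pt m → Pt n) (u : Pt m) (v : Pt m) : Pt n := fun k =>
  fderiv ℝ (fun q => φ q k) u v

/-- The first fundamental form (induced metric) of the immersion `φ`. -/
def fff {m n : ℕ} (g : Met n) (φ : Pt m → Pt n) : Met m := fun u =>
  Matrix.of fun a b => gip g (φ u) (dmap φ u a) (dmap φ u b)

/-- `φ` is a smooth immersion. -/
def IsImmersion {m n : ℕ} (φ : Pt m → Pt n) : Prop :=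
  (∀ k, ContDiff ℝ (⊤ : ℕ∞) fun u => φ u k) ∧ ∀ u, LinearIndependent ℝ (dmap φ u)

/-- `ξ` is a (smooth) unit normal vector field along the immersion `φ`. -/
def IsUnitNormal {m n : ℕ} (g : Met n) (φ ξ : Pt m → Pt n) : Prop :=
  (∀ k, ContDiff ℝ (⊤ : ℕ∞) fun u => ξ u k) ∧ (∀ u, gip g (φ u) (ξ u) (ξ u) = 1) ∧
    ∀ u a, gip g (φ u) (ξ u) (dmap φ u a) = 0

/-- The second fundamental form `h_{ab} = ⟨∇^N_{∂_a} dφ(∂_b), ξ⟩` of `φ` w.r.t. `ξ`. -/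
def sff {m n : ℕ} (g : Met n) (φ ξ : Pt m → Pt n) (u : Pt m) (a b : Fin m) : ℝ :=
  gip g (φ u)
    (fun k => fderiv ℝ (fun q => dmap φ q b k) u (Pi.single a 1)
      + ∑ i, ∑ j, christoffel g (φ u) k i j * dmap φ u a i * dmap φ u b j)
    (ξ u)

/-- The shape operator `A^a_b = G^{ac} h_{cb}` of `φ` w.r.t. `ξ` (`G` the induced metric). -/
def shapeOp {m n : ℕ} (g : Met n) (φ ξ : Pt m → Pt n) (u : Pt m) (a b : Fin m) : ℝ :=
  ∑ c, (fff g φ u)⁻¹ a c * sff g φ ξ u c b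

/-- The mean curvature `H = (1/m) ⋅ trace A` of the hypersurface `φ` w.r.t. `ξ`. -/
def meanCurv {m n : ℕ} (g : Met n) (φ ξ : Pt m → Pt n) (u : Pt m) : ℝ :=
  (1 / (m : ℝ)) * ∑ a, shapeOp g φ ξ u a a

/-- The squared norm `|A|²` of the shape operator (= of the second fundamental form). -/
def normA2 {m n : ℕ} (g : Met n) (φ ξ : Pt m → Pt n) (u : Pt m) : ℝ :=
  ∑ a, ∑ b, shapeOp g φ ξ u a b * shapeOp g φ ξ u b a

/-- `φ` is totally umbilical w.r.t. `ξ`: at every point both principal curvatures are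
equal, i.e. the second fundamental form is a scalar multiple of the induced metric
(equivalently, the shape operator is a scalar multiple of the identity). -/
def IsTotallyUmbilical {m n : ℕ} (g : Met n) (φ ξ : Pt m → Pt n) : Prop :=
  ∃ lam : Pt m → ℝ, ∀ u a b, sff g φ ξ u a b = lam u * fff g φ u a b

/-- The tension field `τ(φ) = Trace_g ∇ dφ` of the isometric immersion `φ`
(the domain carrying the induced metric). -/
def tension {m n : ℕ} (g : Met n) (φ : Pt m → Pt n) (u : Pt m) : Pt n := fun k =>
  ∑ a, ∑ b, (fff g φ u)⁻¹ a b *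
    (fderiv ℝ (fun q => dmap φ q b k) u (Pi.single a 1)
      - ∑ c, christoffel (fff g φ) u c a b * dmap φ u c k
      + ∑ i, ∑ j, christoffel g (φ u) k i j * dmap φ u a i * dmap φ u b j)

/-- The pull-back covariant derivative `∇^φ_{∂_a} V` of a vector field `V` along `φ`. -/
def covAlong {m n : ℕ} (g : Met n) (φ : Pt m → Pt n) (V : Pt m → Pt n) (a : Fin m) :
    Pt m → Pt n := fun u k =>
  fderiv ℝ (fun q => V q k) u (Pi.single a 1)
    + ∑ i, ∑ j, christoffel g (φ u) k i j * dmap φ u a i * V u j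

/-- The bitension field
`τ₂(φ) = Trace_g (∇^φ ∇^φ − ∇^φ_{∇^M}) τ(φ) − Trace_g R^N(dφ, τ(φ)) dφ`. -/
def bitension {m n : ℕ} (g : Met n) (φ : Pt m → Pt n) (u : Pt m) : Pt n := fun k =>
  (∑ a, ∑ b, (fff g φ u)⁻¹ a b *
      (covAlong g φ (covAlong g φ (tension g φ) b) a u k
        - ∑ c, christoffel (fff g φ) u c a b * covAlong g φ (tension g φ) c u k))
    - ∑ a, ∑ b, (fff g φ u)⁻¹ a b *
        curvPt g (φ u) (dmap φ u a) (tension g φ u) (dmap φ u b) k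

/-- `φ` is a biharmonic isometric immersion: its bitension field vanishes.  (This is the
Euler–Lagrange characterisation of the critical points of the bienergy
`E²(φ,Ω) = (1/2)∫_Ω |τ(φ)|²` for every compact `Ω`.) -/
def IsBiharmonic {m n : ℕ} (g : Met n) (φ : Pt m → Pt n) : Prop := ∀ u, bitension g φ u = 0

/-- `φ` is minimal (equivalently, harmonic): its tension field vanishes, i.e. `H ≡ 0`. -/
def IsMinimal {m n : ℕ} (g : Met n) (φ : Pt m → Pt n) : Prop := ∀ u, tension g φ u = 0

/-- `φ` is proper biharmonic: biharmonic and not minimal. -/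
def IsProperBiharmonic {m n : ℕ} (g : Met n) (φ : Pt m → Pt n) : Prop :=
  IsBiharmonic g φ ∧ ¬IsMinimal g φ

/-! ### The Bianchi–Cartan–Vranceanu spaces `M³_{m,l}`, Sol, hyperbolic and flat space -/

/-- `F = 1 + m (x² + y²)`. -/
def bcvF (m : ℝ) (p : Pt 3) : ℝ := 1 + m * (p 0 ^ 2 + p 1 ^ 2)

/-- The coordinate covector of the one-form `dz + (l/2)(y dx − x dy)/F`. -/
def bcvω (m l : ℝ) (p : Pt 3) : Pt 3 :=
  ![l * p 1 / (2 * bcvF m p), -(l * p 0) / (2 * bcvF m p), 1]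

/-- The Bianchi–Cartan–Vranceanu metric
`g = (dx² + dy²)/(1 + m(x²+y²))² + (dz + (l/2)(y dx − x dy)/(1 + m(x²+y²)))²` on `ℝ³`. -/
def bcvMet (m l : ℝ) : Met 3 := fun p =>
  Matrix.of fun i j =>
    (if i = j ∧ (i : ℕ) < 2 then 1 / bcvF m p ^ 2 else 0) + bcvω m l p i * bcvω m l p j

/-- The frame `E₁ = F ∂_x − (l y/2) ∂_z`, `E₂ = F ∂_y + (l x/2) ∂_z`, `E₃ = ∂_z`
on the BCV space `M³_{m,l}`. -/
def bcvE (m l : ℝ) : Fin 3 → VF 3 :=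
  ![fun p => ![bcvF m p, 0, -(l * p 1) / 2],
    fun p => ![0, bcvF m p, l * p 0 / 2],
    fun _ => ![0, 0, 1]]

/-- The base metric `h = (dx² + dy²)/(1 + m(x²+y²))²` on `ℝ²` of the BCV Riemannian
submersion `π : M³_{m,l} → (ℝ², h)`, `π(x,y,z) = (x,y)`. -/
def bcvBase (m : ℝ) : Met 2 := fun p =>
  Matrix.of fun i j => if i = j then 1 / (1 + m * (p 0 ^ 2 + p 1 ^ 2)) ^ 2 else 0

/-- The geodesic curvature of a unit-speed curve `α` in `(ℝ², h)`, with respect to the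
unit normal obtained by rotating `α'` by `+π/2` (a Euclidean rotation, which is also an
`h`-rotation since `h` is conformal to the flat metric). -/
def geodCurv (m : ℝ) (α : ℝ → Pt 2) (s : ℝ) : ℝ :=
  gip (bcvBase m) (α s)
    (fun k => deriv (fun t => deriv α t k) s
      + ∑ i, ∑ j, christoffel (bcvBase m) (α s) k i j * deriv α s i * deriv α s j)
    ![-deriv α s 1, deriv α s 0]

/-- `φ` parametrises part of the Hopf cylinder `π⁻¹(α(I))` over a circle of radius
`1/√(8m − l²)` in the base sphere `S²(1/(2√m))`, identified with `(ℝ², h)`.  (In the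
base sphere, which has Gaussian curvature `4m` and extrinsic normal curvature `2√m`,
the circles of radius `1/√(8m − l²)` are exactly the curves of constant geodesic
curvature `κ₀` with `κ₀² = (8m − l²) − 4m = 4m − l²`.) -/
def PartOfHopfCylinderOverCircle (m l : ℝ) (φ : Pt 2 → Pt 3) : Prop :=
  ∃ α : ℝ → Pt 2, ContDiff ℝ (⊤ : ℕ∞) α ∧
    (∀ s, gip (bcvBase m) (α s) (deriv α s) (deriv α s) = 1) ∧
    (∃ κ₀ : ℝ, κ₀ ^ 2 = 4 * m - l ^ 2 ∧ ∀ s, geodCurv m α s = κ₀) ∧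
    ∀ u, ∃ s, φ u 0 = α s 0 ∧ φ u 1 = α s 1

/-- The Sol metric `g_{Sol} = e^{2z} dx² + e^{−2z} dy² + dz²` on `ℝ³`. -/
def solMet : Met 3 := fun p =>
  Matrix.of fun i j =>
    if i = j then
      if (i : ℕ) = 0 then Real.exp (2 * p 2)
      else if (i : ℕ) = 1 then Real.exp (-(2 * p 2)) else 1
    else 0

/-- The orthonormal frame `E₁ = e^{−z} ∂_x`, `E₂ = e^{z} ∂_y`, `E₃ = ∂_z` on Sol space. -/
def solE : Fin 3 → VF 3 :=
  ![fun p => ![Real.exp (-p 2), 0, 0],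
    fun p => ![0, Real.exp (p 2), 0],
    fun _ => ![0, 0, 1]]

/-- Hyperbolic 3-space `H³` in horospherical coordinates: `g = e^{2z}(dx² + dy²) + dz²`. -/
def hypMet : Met 3 := fun p =>
  Matrix.of fun i j => if i = j then (if (i : ℕ) < 2 then Real.exp (2 * p 2) else 1) else 0

/-- The flat metric on `ℝ³`. -/
def euclMet : Met 3 := fun _ => 1

/-- The second fundamental form evaluated on tangent vectors of the domain. -/
def sffVec {m n : ℕ} (g : Met n) (φ ξ : Pt m → Pt n) (u : Pt m) (v w : Pt m) : ℝ :=
  ∑ a, ∑ b, v a * w b * sff g φ ξ u a b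

/-- lowered Christoffel combination -/
def dG {n : ℕ} (g : Met n) (p : Pt n) (i j l : Fin n) : ℝ :=
  fderiv ℝ (fun q => g q j l) p (Pi.single i 1)
      + fderiv ℝ (fun q => g q i l) p (Pi.single j 1)
      - fderiv ℝ (fun q => g q i j) p (Pi.single l 1)

lemma chris_lower {n : ℕ} (g : Met n) (p : Pt n) (hdet : IsUnit (g p).det)
    (hsym : ∀ i j, g p i j = g p j i) (i j r : Fin n) :
    ∑ k, g p k r * christoffel g p k i j = 1 / 2 * dG g p i j r := by
  have h1 : ∀ k, christoffel g p k i j = ((g p)⁻¹.mulVec (fun l => 1/2 * dG g p i j l)) k := by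
    intro k
    simp only [christoffel, Matrix.mulVec, dotProduct, dG, Finset.mul_sum]
    exact Finset.sum_congr rfl fun _ _ => by ring
  have h2 : ∑ k, g p k r * christoffel g p k i j
      = ((g p).mulVec ((g p)⁻¹.mulVec (fun l => 1/2 * dG g p i j l))) r := by
    rw [Matrix.mulVec, dotProduct]
    exact Finset.sum_congr rfl fun k _ => by rw [h1, hsym]
  rw [h2, Matrix.mulVec_mulVec, Matrix.mul_nonsing_inv _ hdet, Matrix.one_mulVec]

lemma gip_lower {n : ℕ} (g : Met n) (p : Pt n) (hdet : IsUnit (g p).det)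
    (hsym : ∀ i j, g p i j = g p j i) (D v w x : Pt n) :
    gip g p (fun k => D k + ∑ i, ∑ j, christoffel g p k i j * v i * w j) x =
      gip g p D x + 1 / 2 * ∑ i, ∑ j, ∑ r, dG g p i j r * v i * w j * x r := by
  have key : ∑ k, ∑ r, g p k r * (∑ i, ∑ j, christoffel g p k i j * v i * w j) * x r
      = 1 / 2 * ∑ i, ∑ j, ∑ r, dG g p i j r * v i * w j * x r := by
    calc _ = ∑ k, ∑ r, ∑ i, ∑ j, g p k r * christoffel g p k i j * v i * w j * x r := by
          refine Finset.sum_congr rfl fun k _ => Finset.sum_congr rfl fun r _ => ?_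
          simp only [Finset.mul_sum, Finset.sum_mul]
          refine Finset.sum_congr rfl fun i _ => Finset.sum_congr rfl fun j _ => by ring
      _ = ∑ r, ∑ i, ∑ j, ∑ k, g p k r * christoffel g p k i j * v i * w j * x r := by
          rw [Finset.sum_comm]
          refine Finset.sum_congr rfl fun r _ => ?_
          rw [Finset.sum_comm]
          refine Finset.sum_congr rfl fun i _ => ?_
          rw [Finset.sum_comm]
      _ = ∑ r, ∑ i, ∑ j, 1 / 2 * dG g p i j r * v i * w j * x r := by
          refine Finset.sum_congr rfl fun r _ => Finset.sum_congr rfl fun i _ =>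
            Finset.sum_congr rfl fun j _ => ?_
          rw [← chris_lower g p hdet hsym]
          simp only [Finset.sum_mul]
      _ = _ := by
          rw [Finset.sum_comm]
          simp only [Finset.mul_sum]
          refine Finset.sum_congr rfl fun i _ => ?_
          rw [Finset.sum_comm]
          refine Finset.sum_congr rfl fun j _ => Finset.sum_congr rfl fun r _ => by ring
  rw [← key]
  simp only [gip, ← Finset.sum_add_distrib]
  refine Finset.sum_congr rfl fun k _ => Finset.sum_congr rfl fun r _ => by ring

def bdF (m : ℝ) (p v : Pt 3) : ℝ := 2 * m * (p 0 * v 0 + p 1 * v 1)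

def bdω (m l : ℝ) (p v : Pt 3) : Pt 3 :=
  ![l * v 1 / (2 * bcvF m p) - l * p 1 * bdF m p v / (2 * bcvF m p ^ 2),
    -(l * v 0) / (2 * bcvF m p) + l * p 0 * bdF m p v / (2 * bcvF m p ^ 2), 0]

lemma hasLD_coord {n : ℕ} (p v : Pt n) (i : Fin n) :
    HasLineDerivAt ℝ (fun q : Pt n => q i) (v i) p v := by
  have := (hasFDerivAt_apply (𝕜 := ℝ) i p).hasLineDerivAt v
  simpa using this

lemma bcvF_ld (m : ℝ) (p v : Pt 3) : HasLineDerivAt ℝ (bcvF m) (bdF m p v) p v := by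
  have h0 := hasLD_coord p v 0
  have h1 := hasLD_coord p v 1
  unfold HasLineDerivAt at *
  have := (((h0.pow 2).add (h1.pow 2)).const_mul m).const_add 1
  convert! this using 1
  simp [bdF]; ring

lemma bcvω_ld (m l : ℝ) (p v : Pt 3) (hF : bcvF m p ≠ 0) (i : Fin 3) :
    HasLineDerivAt ℝ (fun q => bcvω m l q i) (bdω m l p v i) p v := by
  have h0 := hasLD_coord p v 0
  have h1 := hasLD_coord p v 1
  have hf := bcvF_ld m p v
  unfold HasLineDerivAt at *
  have hF' : (2 * bcvF m (p + (0:ℝ) • v)) ≠ 0 := by simpa using hF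
  fin_cases i
  · convert! (h1.const_mul l).div (hf.const_mul 2) hF' using 1
    simp [bdω]; field_simp
  · convert! ((h0.const_mul l).neg).div (hf.const_mul 2) hF' using 1
    simp [bdω]; field_simp
  · convert! hasDerivAt_const (0:ℝ) (1:ℝ) using 1

lemma bcvF_diff (m : ℝ) : Differentiable ℝ (bcvF m) := by
  unfold bcvF; fun_prop

lemma bcvω_diff (m l : ℝ) (p : Pt 3) (hF : bcvF m p ≠ 0) (i : Fin 3) :
    DifferentiableAt ℝ (fun q => bcvω m l q i) p := by
  have := bcvF_diff m p
  fin_cases i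
  · show DifferentiableAt ℝ (fun q : Pt 3 => l * q 1 / (2 * bcvF m q)) p
    simp only [div_eq_mul_inv]
    exact DifferentiableAt.mul (by fun_prop) (DifferentiableAt.inv (by fun_prop) (by positivity))
  · show DifferentiableAt ℝ (fun q : Pt 3 => -(l * q 0) / (2 * bcvF m q)) p
    simp only [div_eq_mul_inv]
    exact DifferentiableAt.mul (by fun_prop) (DifferentiableAt.inv (by fun_prop) (by positivity))
  · exact differentiableAt_const _

lemma bcvMet_fderiv (m l : ℝ) (p v : Pt 3) (hF : bcvF m p ≠ 0) (i j : Fin 3) :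
    fderiv ℝ (fun q => bcvMet m l q i j) p v =
      (if i = j ∧ (i : ℕ) < 2 then -2 * bdF m p v / bcvF m p ^ 3 else 0)
        + (bdω m l p v i * bcvω m l p j + bcvω m l p i * bdω m l p v j) := by
  have hd : DifferentiableAt ℝ (fun q => bcvMet m l q i j) p := by
    simp only [bcvMet, Matrix.of_apply]
    have := bcvF_diff m p
    refine DifferentiableAt.add ?_ ((bcvω_diff m l p hF i).mul (bcvω_diff m l p hF j))
    split_ifs
    · simp only [div_eq_mul_inv]
      exact DifferentiableAt.mul (by fun_prop) (DifferentiableAt.inv (by fun_prop) (by positivity))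
    · fun_prop
  refine (hd.hasFDerivAt.hasLineDerivAt v).unique ?_
  have hi := bcvω_ld m l p v hF i
  have hj := bcvω_ld m l p v hF j
  have hf := bcvF_ld m p v
  unfold HasLineDerivAt at *
  have hF' : bcvF m (p + (0:ℝ) • v) ^ 2 ≠ 0 := by simpa using hF
  simp only [bcvMet, Matrix.of_apply]
  refine HasDerivAt.add ?_ ?_
  · split_ifs
    · convert! (hasDerivAt_const (0:ℝ) (1:ℝ)).div (hf.pow 2) hF' using 1
      simp; field_simp
    · exact hasDerivAt_const _ _
  · convert! hi.mul hj using 1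
    simp

lemma bcvMet_gip (m l : ℝ) (p v w : Pt 3) :
    gip (bcvMet m l) p v w = (v 0 * w 0 + v 1 * w 1) / bcvF m p ^ 2
      + (∑ i, bcvω m l p i * v i) * (∑ i, bcvω m l p i * w i) := by
  simp [gip, bcvMet, Fin.sum_univ_three]; ring

lemma bcvMet_det (m l : ℝ) (p : Pt 3) (hF : bcvF m p ≠ 0) : IsUnit (bcvMet m l p).det := by
  have : (bcvMet m l p).det = 1 / bcvF m p ^ 4 := by
    simp [Matrix.det_fin_three, bcvMet, bcvω]; field_simp; ring
  rw [this, isUnit_iff_ne_zero]; positivity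

lemma bcvMet_symm (m l : ℝ) (p : Pt 3) (i j : Fin 3) : bcvMet m l p i j = bcvMet m l p j i := by
  fin_cases i <;> fin_cases j <;> simp [bcvMet] <;> ring

/-- contracted lowered Christoffel symbol -/
def Gam {n : ℕ} (g : Met n) (p v w x : Pt n) : ℝ :=
  1 / 2 * ∑ i, ∑ j, ∑ r, dG g p i j r * v i * w j * x r

def bDg (m l : ℝ) (p v w x : Pt 3) : ℝ :=
   (-2 * bdF m p v / bcvF m p ^ 3) * (w 0 * x 0 + w 1 * x 1)
        + ((∑ i, bdω m l p v i * w i) * (∑ i, bcvω m l p i * x i)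
        + (∑ i, bcvω m l p i * w i) * (∑ i, bdω m l p v i * x i))

lemma Gam_bcv (m l : ℝ) (p v w x : Pt 3) (hF : bcvF m p ≠ 0) :
    Gam (bcvMet m l) p v w x =
      1 / 2 * (bDg m l p v w x + bDg m l p w v x - bDg m l p x v w) := by
  simp only [Gam, dG, bcvMet_fderiv m l p _ hF]
  simp [Fin.sum_univ_three, bDg, bdF, bdω, bcvω, Pi.single_apply]
  field_simp
  ring

lemma Gam11 (m l a b : ℝ) (p : Pt 3) (hF : bcvF m p ≠ 0) (hab : a ^ 2 + b ^ 2 = 1) :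
    Gam (bcvMet m l) p (a • bcvE m l 0 p + b • bcvE m l 1 p)
      (a • bcvE m l 0 p + b • bcvE m l 1 p)
      (b • bcvE m l 0 p - a • bcvE m l 1 p) = -(2 * m * (a * p 1 - b * p 0)) := by
  rw [Gam_bcv _ _ _ _ _ _ hF]
  simp [Fin.sum_univ_three, bDg, bdF, bdω, bcvω, bcvE]
  field_simp
  have : b ^ 2 = 1 - a ^ 2 := by linarith
  have h3 : b ^ 3 = b * (1 - a ^ 2) := by rw [← this]; ring
  ring_nf
  simp only [this, h3]
  ring

lemma Gam13 (m l a b : ℝ) (p : Pt 3) (hF : bcvF m p ≠ 0) (hab : a ^ 2 + b ^ 2 = 1) :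
    Gam (bcvMet m l) p (a • bcvE m l 0 p + b • bcvE m l 1 p) (bcvE m l 2 p)
      (b • bcvE m l 0 p - a • bcvE m l 1 p) = l / 2 := by
  rw [Gam_bcv _ _ _ _ _ _ hF]
  have hF2 : m * (p 0 ^ 2 + p 1 ^ 2) = bcvF m p - 1 := by simp [bcvF]
  simp [Fin.sum_univ_three, bDg, bdF, bdω, bcvω, bcvE]
  field_simp
  have : b ^ 2 = 1 - a ^ 2 := by linarith
  ring_nf
  simp only [this]
  linear_combination (-2*l) * hF2

lemma Gam31 (m l a b : ℝ) (p : Pt 3) (hF : bcvF m p ≠ 0) (hab : a ^ 2 + b ^ 2 = 1) :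
    Gam (bcvMet m l) p (bcvE m l 2 p) (a • bcvE m l 0 p + b • bcvE m l 1 p)
      (b • bcvE m l 0 p - a • bcvE m l 1 p) = l / 2 := by
  rw [← Gam13 m l a b p hF hab, Gam_bcv _ _ _ _ _ _ hF, Gam_bcv _ _ _ _ _ _ hF]
  simp only [bDg]; ring

lemma Gam33 (m l a b : ℝ) (p : Pt 3) (hF : bcvF m p ≠ 0) :
    Gam (bcvMet m l) p (bcvE m l 2 p) (bcvE m l 2 p)
      (b • bcvE m l 0 p - a • bcvE m l 1 p) = 0 := by
  rw [Gam_bcv _ _ _ _ _ _ hF]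
  simp [Fin.sum_univ_three, bDg, bdF, bdω, bcvω, bcvE]

lemma fderiv_expand {n : ℕ} (f : Pt n → ℝ) (u v : Pt n) :
    fderiv ℝ f u v = ∑ a, v a * fderiv ℝ f u (Pi.single a 1) := by
  have := LinearMap.pi_apply_eq_sum_univ (fderiv ℝ f u).toLinearMap v
  simp only [ContinuousLinearMap.coe_coe, smul_eq_mul] at this
  rw [this]
  refine Finset.sum_congr rfl fun a _ => ?_
  congr 2
  ext j; simp [Pi.single_apply, eq_comm]

lemma push_eq {m n : ℕ} (φ : Pt m → Pt n) (u v : Pt m) (k : Fin n) :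
    push φ u v k = ∑ a, v a * dmap φ u a k := fderiv_expand _ _ _

lemma gip_xi (m l a b : ℝ) (p v : Pt 3) (hF : bcvF m p ≠ 0) :
    gip (bcvMet m l) p v (b • bcvE m l 0 p - a • bcvE m l 1 p)
      = (b * v 0 - a * v 1) / bcvF m p := by
  rw [bcvMet_gip]
  simp [Fin.sum_univ_three, bcvω, bcvE]
  field_simp
  ring

lemma dmap_contDiff {m n : ℕ} (φ : Pt m → Pt n) (hφ : IsImmersion φ) (a : Fin m) (k : Fin n) :
    ContDiff ℝ (⊤ : ℕ∞) (fun q => dmap φ q a k) := by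
  unfold dmap
  exact (ContDiff.fderiv_right (hφ.1 k) (by simp)).clm_apply contDiff_const

lemma sffVec_eq {n : ℕ} (g : Met n) (φ ξ : Pt 2 → Pt n) (u v w : Pt 2)
    (hdet : IsUnit (g (φ u)).det) (hsym : ∀ i j, g (φ u) i j = g (φ u) j i) :
    sffVec g φ ξ u v w = (∑ a, ∑ b, v a * w b * gip g (φ u)
        (fun k => fderiv ℝ (fun q => dmap φ q b k) u (Pi.single a 1)) (ξ u))
      + Gam g (φ u) (push φ u v) (push φ u w) (ξ u) := by
  have h : ∀ a b, sff g φ ξ u a b = gip g (φ u)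
        (fun k => fderiv ℝ (fun q => dmap φ q b k) u (Pi.single a 1)) (ξ u)
      + Gam g (φ u) (dmap φ u a) (dmap φ u b) (ξ u) := by
    intro a b
    exact gip_lower g (φ u) hdet hsym _ _ _ _
  have h2 : Gam g (φ u) (push φ u v) (push φ u w) (ξ u) =
      ∑ a, ∑ b, v a * w b * Gam g (φ u) (dmap φ u a) (dmap φ u b) (ξ u) := by
    simp only [Gam, push_eq, Fin.sum_univ_two, Finset.mul_sum, ← Finset.sum_add_distrib]
    refine Finset.sum_congr rfl fun i _ => Finset.sum_congr rfl fun j _ =>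
      Finset.sum_congr rfl fun r _ => by ring
  rw [h2]
  simp only [sffVec, h, Fin.sum_univ_two]
  ring

lemma normal_cond {m l : ℝ} {φ ξ : Pt 2 → Pt 3} {a b : Pt 2 → ℝ}
    (hdom : ∀ u, 0 < bcvF m (φ u))
    (hξd : ∀ u, ξ u = b u • bcvE m l 0 (φ u) - a u • bcvE m l 1 (φ u))
    (hξ : IsUnitNormal (bcvMet m l) φ ξ) (u : Pt 2) (c : Fin 2) :
    b u * dmap φ u c 0 - a u * dmap φ u c 1 = 0 := by
  have h := hξ.2.2 u c
  have hF := (hdom u).ne'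
  have hs : gip (bcvMet m l) (φ u) (ξ u) (dmap φ u c)
      = gip (bcvMet m l) (φ u) (dmap φ u c) (ξ u) := by
    rw [bcvMet_gip, bcvMet_gip]; ring
  rw [hs, hξd, gip_xi _ _ _ _ _ _ hF, div_eq_zero_iff] at h
  exact h.resolve_right hF

lemma normal_deriv {m l : ℝ} {φ ξ : Pt 2 → Pt 3} {a b : Pt 2 → ℝ}
    (hφ : IsImmersion φ)
    (hdom : ∀ u, 0 < bcvF m (φ u))
    (hasm : ContDiff ℝ (⊤ : ℕ∞) a) (hbsm : ContDiff ℝ (⊤ : ℕ∞) b)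
    (hξd : ∀ u, ξ u = b u • bcvE m l 0 (φ u) - a u • bcvE m l 1 (φ u))
    (hξ : IsUnitNormal (bcvMet m l) φ ξ) (u v : Pt 2) (c : Fin 2) :
    b u * fderiv ℝ (fun q => dmap φ q c 0) u v - a u * fderiv ℝ (fun q => dmap φ q c 1) u v
     = -(fderiv ℝ b u v * dmap φ u c 0 - fderiv ℝ a u v * dmap φ u c 1) := by
  have hz : (fun q => b q * dmap φ q c 0 - a q * dmap φ q c 1) = fun _ => 0 :=
    funext fun q => normal_cond hdom hξd hξ q c
  have d0 := ((dmap_contDiff φ hφ c 0).differentiable (by simp) u).hasFDerivAt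
  have d1 := ((dmap_contDiff φ hφ c 1).differentiable (by simp) u).hasFDerivAt
  have da := (hasm.differentiable (by simp) u).hasFDerivAt
  have db := (hbsm.differentiable (by simp) u).hasFDerivAt
  have h := (db.mul d0).sub (da.mul d1)
  have h' := h.unique (by
    have := hasFDerivAt_const (0:ℝ) u (𝕜 := ℝ)
    rw [← hz] at this; exact this)
  have := congrArg (fun L => L v) h'
  simp at this
  linarith

lemma sff_formula {m l : ℝ} {φ ξ : Pt 2 → Pt 3} {a b : Pt 2 → ℝ}
    (hφ : IsImmersion φ)
    (hdom : ∀ u, 0 < bcvF m (φ u))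
    (hasm : ContDiff ℝ (⊤ : ℕ∞) a) (hbsm : ContDiff ℝ (⊤ : ℕ∞) b)
    (hξd : ∀ u, ξ u = b u • bcvE m l 0 (φ u) - a u • bcvE m l 1 (φ u))
    (hξ : IsUnitNormal (bcvMet m l) φ ξ) (u v w : Pt 2) :
    sffVec (bcvMet m l) φ ξ u v w =
      -(fderiv ℝ b u v * push φ u w 0 - fderiv ℝ a u v * push φ u w 1) / bcvF m (φ u)
      + Gam (bcvMet m l) (φ u) (push φ u v) (push φ u w) (ξ u) := by
  have hF := (hdom u).ne'
  rw [sffVec_eq _ _ _ _ _ _ (bcvMet_det m l _ hF) (bcvMet_symm m l _)]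
  congr 1
  rw [hξd]
  simp only [gip_xi _ _ _ _ _ _ hF, normal_deriv hφ hdom hasm hbsm hξd hξ u]
  rw [fderiv_expand a u v, fderiv_expand b u v]
  simp only [push_eq, Fin.sum_univ_two]
  field_simp
  ring

lemma sff_symm {n : ℕ} (g : Met n) (φ ξ : Pt 2 → Pt n) (hφ : IsImmersion φ) (u : Pt 2)
    (hdet : IsUnit (g (φ u)).det) (hsym : ∀ p i j, g p i j = g p j i)
    (a b : Fin 2) :
    sff g φ ξ u a b = sff g φ ξ u b a := by
  unfold sff
  congr 1
  ext k
  congr 1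
  · have h := (ContDiffAt.isSymmSndFDerivAt (𝕜 := ℝ) (x := u) (hφ.1 k).contDiffAt
      (by simp only [minSmoothness_of_isRCLikeNormedField]; exact WithTop.coe_le_coe.2 (le_top : (2 : ℕ∞) ≤ ⊤)))
    have h2 := h (Pi.single a 1) (Pi.single b 1)
    have hd : DifferentiableAt ℝ (fderiv ℝ (fun q => φ q k)) u :=
      ((ContDiff.fderiv_right (m := (⊤ : ℕ∞)) (hφ.1 k) (by simp)).differentiable (by simp)) u
    unfold dmap
    rw [fderiv_clm_apply hd (by fun_prop), fderiv_clm_apply hd (by fun_prop)]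
    simpa using h2
  · rw [Finset.sum_comm]
    refine Finset.sum_congr rfl fun i _ => Finset.sum_congr rfl fun j _ => ?_
    have : christoffel g (φ u) k j i = christoffel g (φ u) k i j := by
      unfold christoffel
      congr 1
      refine Finset.sum_congr rfl fun r _ => ?_
      have : (fun q => g q j i) = fun q => g q i j := funext fun q => hsym q j i
      rw [this]; ring
    rw [this]; ring

lemma sffVec_symm {n : ℕ} (g : Met n) (φ ξ : Pt 2 → Pt n) (hφ : IsImmersion φ) (u : Pt 2)
    (hdet : IsUnit (g (φ u)).det) (hsym : ∀ p i j, g p i j = g p j i)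
    (v w : Pt 2) :
    sffVec g φ ξ u v w = sffVec g φ ξ u w v := by
  simp only [sffVec, Fin.sum_univ_two, sff_symm g φ ξ hφ u hdet hsym 1 0]
  ring

lemma trace_lemma {n : ℕ} (g : Met n) (φ ξ : Pt 2 → Pt n) (u w₁ w₂ : Pt 2) (k t : ℝ)
    (h11 : gip g (φ u) (push φ u w₁) (push φ u w₁) = 1)
    (h12 : gip g (φ u) (push φ u w₁) (push φ u w₂) = 0)
    (h21 : gip g (φ u) (push φ u w₂) (push φ u w₁) = 0)
    (h22 : gip g (φ u) (push φ u w₂) (push φ u w₂) = 1)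
    (s11 : sffVec g φ ξ u w₁ w₁ = k) (s12 : sffVec g φ ξ u w₁ w₂ = t)
    (s21 : sffVec g φ ξ u w₂ w₁ = t) (s22 : sffVec g φ ξ u w₂ w₂ = 0) :
    normA2 g φ ξ u = k ^ 2 + 2 * t ^ 2 ∧ meanCurv g φ ξ u = k / 2 := by
  let W : Matrix (Fin 2) (Fin 2) ℝ := !![w₁ 0, w₂ 0; w₁ 1, w₂ 1]
  let G := fff g φ u
  let h : Matrix (Fin 2) (Fin 2) ℝ := Matrix.of (sff g φ ξ u)
  have hpush : ∀ v w : Pt 2, gip g (φ u) (push φ u v) (push φ u w)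
      = ∑ a, ∑ b, v a * w b * G a b := by
    intro v w
    simp only [G, fff, gip, push_eq, Matrix.of_apply, Fin.sum_univ_two, Finset.mul_sum,
      ← Finset.sum_add_distrib]
    refine Finset.sum_congr rfl fun i _ => Finset.sum_congr rfl fun j _ => by ring
  rw [hpush] at h11 h12 h21 h22
  have hG : W.transpose * G * W = 1 := by
    simp only [Fin.sum_univ_two] at h11 h12 h21 h22
    ext i j
    fin_cases i <;> fin_cases j <;>
      simp [W, Matrix.mul_apply, Fin.sum_univ_two] <;> linarith
  have hS : W.transpose * h * W = !![k, t; t, 0] := by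
    simp only [sffVec, Fin.sum_univ_two] at s11 s12 s21 s22
    ext i j
    fin_cases i <;> fin_cases j <;>
      simp [W, h, Matrix.mul_apply, Fin.sum_univ_two] <;> linarith
  have hinv : G⁻¹ = W * W.transpose := by
    apply Matrix.inv_eq_left_inv
    rw [Matrix.mul_assoc]
    exact mul_eq_one_comm.1 hG
  have hA : ∀ a b, shapeOp g φ ξ u a b = (G⁻¹ * h) a b := by
    intro a b; simp [shapeOp, Matrix.mul_apply, G, h]
  constructor
  · have e1 : normA2 g φ ξ u = ((G⁻¹ * h) * (G⁻¹ * h)).trace := by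
      simp only [normA2, hA, Matrix.trace, Matrix.diag, Matrix.mul_apply]
    rw [e1, hinv]
    have e2 : (W * W.transpose * h * (W * W.transpose * h)) =
        W * ((W.transpose * h * W) * (W.transpose * h)) := by simp only [Matrix.mul_assoc]
    rw [e2, Matrix.trace_mul_comm, Matrix.mul_assoc, hS]
    simp [Matrix.trace_fin_two]; ring
  · have e1 : meanCurv g φ ξ u = 1 / 2 * (G⁻¹ * h).trace := by
      simp only [meanCurv, hA, Matrix.trace, Matrix.diag]; norm_num
    rw [e1, hinv, Matrix.mul_assoc, Matrix.trace_mul_comm, hS]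
    simp [Matrix.trace_fin_two]; ring

lemma part_one
    (m l : ℝ) (φ ξ e₁ e₂ : Pt 2 → Pt 3) (a b : Pt 2 → ℝ) (w₁ w₂ : Pt 2 → Pt 2)
    (hφ : IsImmersion φ) (hdom : ∀ u, 0 < bcvF m (φ u))
    (hab : ∀ u, a u ^ 2 + b u ^ 2 = 1)
    (hasm : ContDiff ℝ (⊤ : ℕ∞) a) (hbsm : ContDiff ℝ (⊤ : ℕ∞) b)
    (he₁ : ∀ u, e₁ u = a u • bcvE m l 0 (φ u) + b u • bcvE m l 1 (φ u))
    (he₂ : ∀ u, e₂ u = bcvE m l 2 (φ u))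
    (hξd : ∀ u, ξ u = b u • bcvE m l 0 (φ u) - a u • bcvE m l 1 (φ u))
    (hξ : IsUnitNormal (bcvMet m l) φ ξ)
    (hw₁ : ∀ u, push φ u (w₁ u) = e₁ u) (hw₂ : ∀ u, push φ u (w₂ u) = e₂ u) (u : Pt 2) :
    (sffVec (bcvMet m l) φ ξ u (w₁ u) (w₁ u) =
        -(a u * fderiv ℝ b u (w₁ u) - b u * fderiv ℝ a u (w₁ u)
          + 2 * m * (a u * φ u 1 - b u * φ u 0))) ∧
    (sffVec (bcvMet m l) φ ξ u (w₁ u) (w₂ u) = l / 2) ∧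
    (sffVec (bcvMet m l) φ ξ u (w₂ u) (w₂ u) = 0) ∧
    (fderiv ℝ a u (w₂ u) = 0 ∧ fderiv ℝ b u (w₂ u) = 0) ∧
    (normA2 (bcvMet m l) φ ξ u =
      (a u * fderiv ℝ b u (w₁ u) - b u * fderiv ℝ a u (w₁ u)
          + 2 * m * (a u * φ u 1 - b u * φ u 0)) ^ 2 + l ^ 2 / 2) ∧
    (meanCurv (bcvMet m l) φ ξ u =
      -(a u * fderiv ℝ b u (w₁ u) - b u * fderiv ℝ a u (w₁ u)
          + 2 * m * (a u * φ u 1 - b u * φ u 0)) / 2) := by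
  have hF := (hdom u).ne'
  have hs := sff_formula hφ hdom hasm hbsm hξd hξ u
  have p1 : push φ u (w₁ u) = a u • bcvE m l 0 (φ u) + b u • bcvE m l 1 (φ u) := by
    rw [hw₁, he₁]
  have p2 : push φ u (w₂ u) = bcvE m l 2 (φ u) := by rw [hw₂, he₂]
  have s11 : sffVec (bcvMet m l) φ ξ u (w₁ u) (w₁ u) =
        -(a u * fderiv ℝ b u (w₁ u) - b u * fderiv ℝ a u (w₁ u)
          + 2 * m * (a u * φ u 1 - b u * φ u 0)) := by
    rw [hs, p1, hξd, Gam11 _ _ _ _ _ hF (hab u)]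
    simp [bcvE]; field_simp; ring
  have s12 : sffVec (bcvMet m l) φ ξ u (w₁ u) (w₂ u) = l / 2 := by
    rw [hs, p1, p2, hξd, Gam13 _ _ _ _ _ hF (hab u)]
    simp [bcvE]
  have s22 : sffVec (bcvMet m l) φ ξ u (w₂ u) (w₂ u) = 0 := by
    rw [hs, p2, hξd, Gam33 _ _ _ _ _ hF]
    simp [bcvE]
  have s21' : sffVec (bcvMet m l) φ ξ u (w₂ u) (w₁ u) = l / 2 := by
    rw [sffVec_symm _ _ _ hφ u (bcvMet_det m l _ hF) (bcvMet_symm m l), s12]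
  have s21 := s21'
  rw [hs, p1, p2, hξd, Gam31 _ _ _ _ _ hF (hab u)] at s21
  have k1 : a u * fderiv ℝ b u (w₂ u) - b u * fderiv ℝ a u (w₂ u) = 0 := by
    simp [bcvE] at s21
    rcases s21 with h | h
    · have : bcvF m (φ u) * (a u * fderiv ℝ b u (w₂ u) - b u * fderiv ℝ a u (w₂ u)) = 0 := by
        linarith
      exact (mul_eq_zero.1 this).resolve_left hF
    · exact absurd h hF
  have k2 : a u * fderiv ℝ a u (w₂ u) + b u * fderiv ℝ b u (w₂ u) = 0 := by
    have da := (hasm.differentiable (by simp) u).hasFDerivAt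
    have db := (hbsm.differentiable (by simp) u).hasFDerivAt
    have h := (da.mul da).add (db.mul db)
    have hz : (a * a + b * b) = fun _ => (1:ℝ) := funext fun q => by
      have := hab q; simp; nlinarith
    rw [hz] at h
    have h' := h.unique (hasFDerivAt_const (1:ℝ) u)
    have := congrArg (fun L => L (w₂ u)) h'
    simp at this
    linarith
  have g11 : gip (bcvMet m l) (φ u) (push φ u (w₁ u)) (push φ u (w₁ u)) = 1 := by
    rw [p1, bcvMet_gip]; simp [Fin.sum_univ_three, bcvω, bcvE]; field_simp
    linear_combination 4 * hab u
  have g12 : gip (bcvMet m l) (φ u) (push φ u (w₁ u)) (push φ u (w₂ u)) = 0 := by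
    rw [p1, p2, bcvMet_gip]; simp [Fin.sum_univ_three, bcvω, bcvE]; field_simp
    ring
  have g21 : gip (bcvMet m l) (φ u) (push φ u (w₂ u)) (push φ u (w₁ u)) = 0 := by
    rw [← g12, bcvMet_gip, bcvMet_gip]; ring
  have g22 : gip (bcvMet m l) (φ u) (push φ u (w₂ u)) (push φ u (w₂ u)) = 1 := by
    rw [p2, bcvMet_gip]; simp [Fin.sum_univ_three, bcvω, bcvE]
  have tr := trace_lemma (bcvMet m l) φ ξ u (w₁ u) (w₂ u) _ _ g11 g12 g21 g22 s11 s12 s21' s22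
  refine ⟨s11, s12, s22, ⟨?_, ?_⟩, ?_, tr.2⟩
  · linear_combination (-fderiv ℝ a u (w₂ u)) * hab u + a u * k2 - b u * k1
  · linear_combination (-fderiv ℝ b u (w₂ u)) * hab u + b u * k2 + a u * k1
  · rw [tr.1]; ring

lemma const_on {s : Set ℝ} (hs : Convex ℝ s) (f : ℝ → ℂ) (hf : ∀ t ∈ s, HasDerivAt f 0 t)
    {x y : ℝ} (hx : x ∈ s) (hy : y ∈ s) : f y = f x := by
  have := hs.norm_image_sub_le_of_norm_hasDerivWithin_le (C := 0)
    (fun t ht => (hf t ht).hasDerivWithinAt) (by simp) hx hy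
  simpa [sub_eq_zero] using this

lemma diff_const_on {s : Set ℝ} (hs : Convex ℝ s) (f g : ℝ → ℂ) (d : ℝ → ℂ)
    (hf : ∀ t ∈ s, HasDerivAt f (d t) t) (hg : ∀ t ∈ s, HasDerivAt g (d t) t)
    {x y : ℝ} (hx : x ∈ s) (hy : y ∈ s) : f y = g y + (f x - g x) := by
  have := const_on hs (f - g) (fun t ht => by simpa using (hf t ht).sub (hg t ht)) hx hy
  simp at this
  linear_combination this

lemma exists_prim (w : ℝ → ℂ) (hw : ContDiff ℝ (⊤ : ℕ∞) w) (x₀ : ℝ) (c : ℂ) :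
    ∃ W : ℝ → ℂ, ContDiff ℝ (⊤ : ℕ∞) W ∧ (∀ t, HasDerivAt W (w t) t) ∧ W x₀ = c := by
  have hd : ∀ t, HasDerivAt (fun t => c + ∫ x in x₀..t, w x) (w t) t := by
    intro t
    exact (intervalIntegral.integral_hasDerivAt_right
      (hw.continuous.intervalIntegrable _ _)
      hw.continuous.stronglyMeasurable.stronglyMeasurableAtFilter
      hw.continuous.continuousAt).const_add c
  refine ⟨fun t => c + ∫ x in x₀..t, w x, ?_, hd, by simp⟩
  rw [contDiff_infty_iff_deriv]
  refine ⟨fun t => (hd t).differentiableAt, ?_⟩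
  rw [show deriv (fun t => c + ∫ x in x₀..t, w x) = w from funext fun t => (hd t).deriv]
  exact hw

/-- the standard rotating exponential -/
def ex (t : ℝ) : ℂ := Complex.exp (t * Complex.I)

lemma ex_contDiff : ContDiff ℝ (⊤ : ℕ∞) ex := by
  unfold ex
  exact ((Complex.ofRealCLM.contDiff).mul contDiff_const).cexp

lemma ex_deriv (t : ℝ) : HasDerivAt ex (Complex.I * ex t) t := by
  unfold ex
  have := (((hasDerivAt_id t).ofReal_comp).mul_const Complex.I).cexp
  convert! this using 1
  simp; ring

lemma ex_add (s t : ℝ) : ex (s + t) = ex s * ex t := by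
  unfold ex; rw [← Complex.exp_add]; push_cast; ring_nf

lemma ex_neg_mul (t : ℝ) : ex t * ex (-t) = 1 := by
  rw [← ex_add]; simp [ex]

lemma ex_two_pi (n : ℤ) : ex (n * (2 * Real.pi)) = 1 := by
  unfold ex
  rw [Complex.exp_eq_one_iff]
  exact ⟨n, by push_cast; ring⟩

lemma exists_S : ∃ (S : ℝ → ℂ) (b : ℝ → ℝ) (B : ℂ), ContDiff ℝ (⊤ : ℕ∞) S ∧ B ≠ 0 ∧
    (∀ t, 0 ≤ b t) ∧ (∀ t, HasDerivAt S (b t * (Complex.I * ex t)) t) ∧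
    (∀ t ≤ -1, S t = 0) ∧ (∀ t ≥ 1, S t = B) := by
  let b : ContDiffBump (0:ℝ) := ⟨1/2, 1, by norm_num, by norm_num⟩
  have hb : ContDiff ℝ (⊤ : ℕ∞) (b : ℝ → ℝ) := b.contDiff
  obtain ⟨S, hS, hSd, hS0⟩ := exists_prim (fun t => (b t : ℂ) * (Complex.I * ex t))
    ((Complex.ofRealCLM.contDiff.comp hb).mul (contDiff_const.mul ex_contDiff)) (-1) 0
  have hz : ∀ t, 1 ≤ |t| → b t = 0 := fun t ht => b.zero_of_le_dist (by simpa using ht)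
  refine ⟨S, b, S 1, hS, ?_, fun t => b.nonneg, hSd, ?_, ?_⟩
  · have hmono : StrictMonoOn (fun t => (S t).im) (Set.Icc (-1) 1) := by
      have hd : ∀ t, HasDerivAt (fun t => (S t).im) (b t * Real.cos t) t := by
        intro t
        have := (Complex.imCLM.hasFDerivAt (x := S t)).comp_hasDerivAt t (hSd t)
        convert! this using 1
        simp [ex, Complex.exp_ofReal_mul_I_re]
      apply strictMonoOn_of_deriv_pos (convex_Icc _ _)
      · exact fun t _ => (hd t).continuousAt.continuousWithinAt
      · intro t ht
        rw [interior_Icc] at ht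
        rw [(hd t).deriv]
        refine mul_pos (b.pos_of_mem_ball ?_) (Real.cos_pos_of_mem_Ioo ⟨?_, ?_⟩)
        · simp [b, abs_lt]; exact ht
        · linarith [ht.1, Real.pi_gt_three]
        · linarith [ht.2, Real.pi_gt_three]
    have := hmono (by simp : (-1:ℝ) ∈ _) (by simp : (1:ℝ) ∈ _) (by norm_num)
    simp only [hS0] at this
    intro h
    rw [h] at this
    exact lt_irrefl _ this
  · intro t ht
    rw [← hS0]
    refine const_on (convex_Iic (-1)) S (fun t ht => ?_) (by simp) ht
    have := hSd t
    rwa [hz t (by rw [abs_of_nonpos] <;> linarith [Set.mem_Iic.1 ht]), Complex.ofReal_zero,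
      zero_mul] at this
  · intro t ht
    refine const_on (convex_Ici 1) S (fun t ht => ?_) (by simp) ht
    have := hSd t
    rwa [hz t (by rw [abs_of_nonneg] <;> linarith [Set.mem_Ici.1 ht]), Complex.ofReal_zero,
      zero_mul] at this

lemma exists_corr (K : ℂ) (n : ℤ) : ∃ (Q : ℝ → ℂ) (r : ℝ → ℝ), ContDiff ℝ (⊤ : ℕ∞) Q ∧
    (∀ t, 0 ≤ r t) ∧ (∀ t, HasDerivAt Q (r t * (Complex.I * ex t)) t) ∧
    (∀ t ≤ n * (2 * Real.pi) - Real.pi - 1, Q t = 0) ∧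
    (∀ t ≥ n * (2 * Real.pi) + Real.pi + 1, Q t = K) := by
  obtain ⟨S, b, B, hS, hB, hb, hSd, hS0, hS1⟩ := exists_S
  set s : ℝ := Complex.arg (K / B) + n * (2 * Real.pi) with hs
  have hexs : (‖K / B‖ : ℂ) * ex s = K / B := by
    rw [hs, ex_add, ex_two_pi, mul_one]
    exact Complex.norm_mul_exp_arg_mul_I _
  have ha1 := Complex.neg_pi_lt_arg (K / B)
  have ha2 := Complex.arg_le_pi (K / B)
  refine ⟨fun t => ((‖K / B‖ : ℂ) * ex s) * S (t - s), fun t => ‖K / B‖ * b (t - s), ?_, ?_, ?_, ?_, ?_⟩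
  · exact contDiff_const.mul (hS.comp (contDiff_id.sub contDiff_const))
  · intro t; exact mul_nonneg (norm_nonneg _) (hb _)
  · intro t
    have := ((hSd (t - s)).comp_sub_const t s).const_mul ((‖K / B‖ : ℂ) * ex s)
    convert! this using 1
    have : ex t = ex s * ex (t - s) := by rw [← ex_add]; ring_nf
    rw [this]; push_cast; ring
  · intro t ht
    simp only
    rw [hS0 _ (by linarith), mul_zero]
  · intro t ht
    simp only
    rw [hS1 _ (by linarith), hexs]
    field_simp

lemma block (c : ℝ → ℂ) (θ ε : ℝ) (h1 : -Real.pi < θ) (h2 : θ ≤ Real.pi) (hε : 0 < ε)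
    (hε1 : ε ≤ 1 / 2) (hc : ∀ t, |t| < 3 * ε → ContDiffAt ℝ (⊤ : ℕ∞) c t)
    (hH : ∀ t, |t| < 3 * ε → 0 < (deriv c t * ex (-(θ + t))).im) :
    ∃ g : ℝ → ℂ, ContDiff ℝ (⊤ : ℕ∞) g ∧ (∀ t, deriv g t ≠ 0) ∧ (∀ t ≤ 1, g t = ex t) ∧
      (∀ t ≥ 13 * Real.pi, g t = ex t) ∧ ∀ t, |t| ≤ ε → g (θ + 6 * Real.pi + t) = c t := by
  have hpi := Real.pi_gt_three
  set T := θ + 6 * Real.pi with hT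
  let χ : ContDiffBump (0:ℝ) := ⟨ε, 2 * ε, hε, by linarith⟩
  have hχ : ContDiff ℝ (⊤ : ℕ∞) (χ : ℝ → ℝ) := χ.contDiff
  have hχ0 : ∀ t, 2 * ε ≤ |t| → χ t = 0 := fun t ht => χ.zero_of_le_dist (by simpa using ht)
  have hχ1 : ∀ t, |t| ≤ ε → χ t = 1 := fun t ht => χ.one_of_mem_closedBall (by simpa using ht)
  let w0 : ℝ → ℂ := fun t => ((1 - χ (t - T) : ℝ) : ℂ) * (Complex.I * ex t)
      + (χ (t - T) : ℂ) * deriv c (t - T)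
  have hχc : ContDiff ℝ (⊤ : ℕ∞) (fun t => (χ t : ℂ)) := Complex.ofRealCLM.contDiff.comp hχ
  have hq : ContDiff ℝ (⊤ : ℕ∞) (fun t => (χ t : ℂ) * deriv c t) := by
    rw [contDiff_iff_contDiffAt]
    intro t
    by_cases ht : |t| < 3 * ε
    · refine hχc.contDiffAt.mul ?_
      exact ((hc t ht).fderiv_right (m := (⊤ : ℕ∞)) (by simp)).clm_apply contDiffAt_const
    · have : (fun t => (χ t : ℂ) * deriv c t) =ᶠ[nhds t] fun _ => 0 := by
        have ho : IsOpen {x : ℝ | 2 * ε < |x|} := isOpen_lt continuous_const continuous_abs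
        filter_upwards [ho.mem_nhds (show 2 * ε < |t| by linarith)] with x hx
        rw [hχ0 x (le_of_lt hx)]; simp
      exact contDiffAt_const.congr_of_eventuallyEq this
  have hw0 : ContDiff ℝ (⊤ : ℕ∞) w0 := by
    refine ContDiff.add (ContDiff.mul ?_ (contDiff_const.mul ex_contDiff))
      (hq.comp (contDiff_id.sub contDiff_const))
    exact Complex.ofRealCLM.contDiff.comp
      (contDiff_const.sub (hχ.comp (contDiff_id.sub contDiff_const)))
  obtain ⟨g0, hg0, hg0d, hg00⟩ := exists_prim w0 hw0 0 1
  -- left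
  have hout : ∀ t, 2 * ε ≤ |t - T| → HasDerivAt g0 (Complex.I * ex t) t := by
    intro t ht
    have := hg0d t
    simp only [w0, hχ0 _ ht] at this
    simpa using this
  have hL : ∀ t ≤ T - 2 * ε, g0 t = ex t := by
    intro t ht
    have := diff_const_on (convex_Iic (T - 2 * ε)) g0 ex (fun t => Complex.I * ex t)
      (fun t ht => hout t (by rw [abs_of_nonpos] <;> linarith [Set.mem_Iic.1 ht]))
      (fun t _ => ex_deriv t) (x := 0) (y := t) (by simp; linarith) ht
    rw [this, hg00]; simp [ex]
  set K1 := g0 T - c 0 with hK1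
  have hM : ∀ t, |t| ≤ ε → g0 (T + t) = c t + K1 := by
    intro t ht
    have := diff_const_on (convex_Icc (-ε) ε) (fun t => g0 (T + t)) c (deriv c)
      (fun t ht => by
        have h := (hg0d (T + t)).comp_const_add T t
        have ht' : |t| ≤ ε := abs_le.2 ht
        have e : w0 (T + t) = deriv c t := by
          simp [w0, hχ1 t ht']
        rwa [e] at h)
      (fun t ht => ((hc t (by have := abs_le.2 ht; linarith)).differentiableAt
        (by simp)).hasDerivAt)
      (x := 0) (y := t) (by simp; exact hε.le) (abs_le.1 ht)
    simpa using this
  set K2 := g0 (T + 2 * ε) - ex (T + 2 * ε) with hK2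
  have hR : ∀ t ≥ T + 2 * ε, g0 t = ex t + K2 := by
    intro t ht
    exact diff_const_on (convex_Ici (T + 2 * ε)) g0 ex (fun t => Complex.I * ex t)
      (fun t ht => hout t (by rw [abs_of_nonneg] <;> linarith [Set.mem_Ici.1 ht]))
      (fun t _ => ex_deriv t) (x := T + 2 * ε) (y := t) (by simp) ht
  obtain ⟨Q1, r1, hQ1, hr1, hQ1d, hQ1L, hQ1R⟩ := exists_corr (-K1) 1
  obtain ⟨Q2, r2, hQ2, hr2, hQ2d, hQ2L, hQ2R⟩ := exists_corr (K1 - K2) 5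
  push_cast at hQ1L hQ1R hQ2L hQ2R
  refine ⟨fun t => g0 t + Q1 t + Q2 t, (hg0.add hQ1).add hQ2, ?_, ?_, ?_, ?_⟩
  · intro t
    have hd := ((hg0d t).add (hQ1d t)).add (hQ2d t)
    rw [show deriv (fun t => g0 t + Q1 t + Q2 t) t = _ from hd.deriv]
    intro h0
    have h := congrArg (fun z => (z * ex (-t)).im) h0
    have e : (w0 t + (r1 t) * (Complex.I * ex t) + (r2 t) * (Complex.I * ex t)) * ex (-t)
        = ((1 - χ (t - T) + r1 t + r2 t : ℝ) : ℂ) * Complex.I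
          + ((χ (t - T) : ℝ) : ℂ) * (deriv c (t - T) * ex (-(θ + (t - T)))) := by
      have e1 := ex_neg_mul t
      have e2 : ex (-(θ + (t - T))) = ex (-t) := by
        have : -(θ + (t - T)) = -t + ((3:ℤ):ℝ) * (2 * Real.pi) := by
          rw [hT]; push_cast; ring
        rw [this, ex_add, ex_two_pi, mul_one]
      rw [e2]
      simp only [w0]
      push_cast
      linear_combination ((1 - (χ (t - T) : ℂ) + r1 t + r2 t) * Complex.I) * e1
    simp only [zero_mul, Complex.zero_im] at h
    rw [e] at h
    simp only [Complex.add_im, Complex.im_ofReal_mul, Complex.I_im,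
      mul_one] at h
    have a0 := hr1 t
    have a1 := hr2 t
    have a2 : 0 ≤ χ (t - T) := χ.nonneg
    have a3 : χ (t - T) ≤ 1 := χ.le_one
    by_cases hx : |t - T| < 3 * ε
    · have a4 := hH (t - T) hx
      have a5 : 0 ≤ χ (t - T) * (deriv c (t - T) * ex (-(θ + (t - T)))).im :=
        mul_nonneg a2 a4.le
      have a6 : χ (t - T) * (deriv c (t - T) * ex (-(θ + (t - T)))).im = 0 := by linarith
      rcases mul_eq_zero.1 a6 with h' | h'
      · rw [h'] at h; linarith
      · exact a4.ne' h'
    · rw [hχ0 (t - T) (by linarith)] at h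
      linarith
  · intro t ht
    simp only
    rw [hL t (by linarith), hQ1L t (by linarith), hQ2L t (by linarith)]; simp
  · intro t ht
    simp only
    rw [hR t (by linarith), hQ1R t (by linarith), hQ2R t (by linarith)]; ring
  · intro t ht
    have := abs_le.1 ht
    simp only
    rw [hM t ht, hQ1R _ (by linarith), hQ2L _ (by linarith)]; ring

lemma chain (g : ℤ → ℝ → ℂ) (hg : ∀ n, ContDiff ℝ (⊤ : ℕ∞) (g n))
    (hg' : ∀ n t, deriv (g n) t ≠ 0) (hL : ∀ n, ∀ t ≤ 1, g n t = ex t)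
    (hR : ∀ n, ∀ t ≥ 13 * Real.pi, g n t = ex t) :
    ∃ γ : ℝ → ℂ, ContDiff ℝ (⊤ : ℕ∞) γ ∧ (∀ t, deriv γ t ≠ 0) ∧
      ∀ (n : ℤ) (t : ℝ), -1 ≤ t → t ≤ 14 * Real.pi + 1 → γ (14 * Real.pi * n + t) = g n t := by
  have hpi := Real.pi_gt_three
  set P := 14 * Real.pi with hP
  have hP0 : 0 < P := by positivity
  have hper : ∀ t, ex (t + P) = ex t := by
    intro t
    have : P = ((7:ℤ):ℝ) * (2 * Real.pi) := by rw [hP]; push_cast; ring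
    rw [this, ex_add, ex_two_pi, mul_one]
  let γ : ℝ → ℂ := fun t => g ⌊t / P⌋ (t - P * ⌊t / P⌋)
  have hfl : ∀ (n : ℤ) (t : ℝ), 0 ≤ t → t < P → γ (P * n + t) = g n t := by
    intro n t h0 h1
    have : ⌊(P * n + t) / P⌋ = n := by
      rw [Int.floor_eq_iff, le_div_iff₀ hP0, div_lt_iff₀ hP0]
      constructor <;> nlinarith
    simp only [γ, this]
    congr 1; ring
  have key : ∀ (n : ℤ) (t : ℝ), -1 ≤ t → t ≤ P + 1 → γ (P * n + t) = g n t := by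
    intro n t h0 h1
    rcases lt_or_ge t 0 with h | h
    · have := hfl (n - 1) (t + P) (by linarith) (by linarith)
      rw [show P * n + t = P * ((n - 1 : ℤ) : ℝ) + (t + P) by push_cast; ring, this,
        hR _ _ (by linarith), hL _ _ (by linarith), hper]
    · rcases lt_or_ge t P with h' | h'
      · exact hfl n t h h'
      · have := hfl (n + 1) (t - P) (by linarith) (by linarith)
        rw [show P * n + t = P * ((n + 1 : ℤ) : ℝ) + (t - P) by push_cast; ring, this,
          hL _ _ (by linarith), hR _ t (by linarith), ← hper]
        congr 1; ring
  have loc : ∀ t : ℝ, ∃ n : ℤ, γ =ᶠ[nhds t] fun s => g n (s - P * n) := by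
    intro t
    refine ⟨⌊t / P⌋, ?_⟩
    set n := ⌊t / P⌋
    have h0 : (n : ℝ) * P ≤ t := (le_div_iff₀ hP0).1 (Int.floor_le _)
    have h1 : t < (n + 1 : ℝ) * P := (div_lt_iff₀ hP0).1 (Int.lt_floor_add_one _)
    filter_upwards [Ioo_mem_nhds (show t - 1 < t by linarith) (show t < t + 1 by linarith)]
      with s hs
    rw [← key n (s - P * n) (by linarith [hs.1]) (by linarith [hs.2])]
    congr 1; ring
  refine ⟨γ, ?_, ?_, key⟩
  · rw [contDiff_iff_contDiffAt]
    intro t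
    obtain ⟨n, hn⟩ := loc t
    exact (((hg n).comp (contDiff_id.sub contDiff_const)).contDiffAt).congr_of_eventuallyEq hn
  · intro t
    obtain ⟨n, hn⟩ := loc t
    rw [hn.deriv_eq, deriv_comp_sub_const]
    exact hg' n _

lemma reparam (ρ : ℝ → ℝ) (hρ : ContDiff ℝ (⊤ : ℕ∞) ρ) (hpos : ∀ t, 0 < ρ t) (P : ℝ)
    (hP : 2 ≤ P) (hper : ∀ (n : ℤ) (t : ℝ), |t| ≤ 1 / 2 → ρ (P * n + t) = ρ t) :
    ∃ τ σ : ℝ → ℝ, ContDiff ℝ (⊤ : ℕ∞) τ ∧ (∀ t, τ (σ t) = t) ∧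
      (∀ s, HasDerivAt τ (1 / ρ (τ s)) s) := by
  have hd : ∀ t, HasDerivAt (fun t => ∫ x in (0:ℝ)..t, ρ x) (ρ t) t := by
    intro t
    exact intervalIntegral.integral_hasDerivAt_right
      (hρ.continuous.intervalIntegrable _ _)
      hρ.continuous.stronglyMeasurable.stronglyMeasurableAtFilter
      hρ.continuous.continuousAt
  set σ : ℝ → ℝ := fun t => ∫ x in (0:ℝ)..t, ρ x with hσ
  have hσc : ContDiff ℝ (⊤ : ℕ∞) σ := by
    rw [contDiff_infty_iff_deriv]
    refine ⟨fun t => (hd t).differentiableAt, ?_⟩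
    rw [show deriv σ = ρ from funext fun t => (hd t).deriv]
    exact hρ
  have hmono : StrictMono σ := strictMono_of_deriv_pos fun t => by
    rw [(hd t).deriv]; exact hpos t
  set Ln := σ (1/2) - σ (-(1/2)) with hLn
  have hLn0 : 0 < Ln := sub_pos.2 (hmono (by norm_num))
  have hstep : ∀ n : ℤ, σ (P * n + 1/2) = σ (P * n - 1/2) + Ln := by
    intro n
    have := (convex_Icc (-(1/2):ℝ) (1/2)).norm_image_sub_le_of_norm_hasDerivWithin_le (C := 0)
      (f := fun t => σ (P * n + t) - σ t) (f' := fun t => 0)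
      (fun t ht => by
        have h := (((hd (P * n + t)).comp_const_add (P * n) t).sub (hd t))
        rw [hper n t (abs_le.2 ht), sub_self] at h
        exact h.hasDerivWithinAt) (by simp)
      (x := -(1/2)) (y := 1/2) (by norm_num) (by norm_num)
    simp only [zero_mul, norm_le_zero_iff] at this
    rw [sub_eq_add_neg (P * (n:ℝ))]
    linarith
  have hstep2 : ∀ n : ℤ, σ (P * n - 1/2) + Ln ≤ σ (P * ((n + 1 : ℤ) : ℝ) - 1/2) := by
    intro n
    rw [← hstep]
    apply hmono.monotone
    push_cast
    linarith
  have hup : ∀ n : ℕ, σ (-(1/2)) + n * Ln ≤ σ (P * n - 1/2) := by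
    intro n
    induction n with
    | zero => simp
    | succ k ih =>
      have := hstep2 k
      push_cast at this ⊢
      linarith
  have hdn : ∀ n : ℕ, σ (P * (-n) - 1/2) ≤ σ (-(1/2)) - n * Ln := by
    intro n
    induction n with
    | zero => simp
    | succ k ih =>
      have := hstep2 (-(k + 1))
      push_cast at this ⊢
      rw [show (-((k:ℝ) + 1) + 1) = -k by ring] at this
      linarith
  have htop : Filter.Tendsto σ Filter.atTop Filter.atTop := by
    refine Filter.tendsto_atTop_atTop_of_monotone hmono.monotone fun b => ?_
    obtain ⟨n, hn⟩ := exists_nat_ge ((b - σ (-(1/2))) / Ln)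
    rw [div_le_iff₀ hLn0] at hn
    exact ⟨P * n - 1/2, by linarith [hup n]⟩
  have hbot : Filter.Tendsto σ Filter.atBot Filter.atBot := by
    refine Filter.tendsto_atBot_atBot_of_monotone hmono.monotone fun b => ?_
    obtain ⟨n, hn⟩ := exists_nat_ge ((σ (-(1/2)) - b) / Ln)
    rw [div_le_iff₀ hLn0] at hn
    exact ⟨P * (-n) - 1/2, by linarith [hdn n]⟩
  have hsurj : Function.Surjective σ := hσc.continuous.surjective htop hbot
  let e : ℝ ≃o ℝ := hmono.orderIsoOfSurjective σ hsurj
  have he : ∀ t, e t = σ t := fun t => rfl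
  let H : ℝ ≃ₜ ℝ := e.toHomeomorph
  have hH : ∀ t, H t = σ t := fun t => rfl
  have hτ : ContDiff ℝ (⊤ : ℕ∞) (H.symm : ℝ → ℝ) :=
    H.contDiff_symm_deriv (f' := ρ) (fun t => (hpos t).ne') hd hσc
  refine ⟨H.symm, σ, hτ, fun t => H.symm_apply_apply t, fun s => ?_⟩
  have := HasDerivAt.of_local_left_inverse (f := σ) (g := H.symm) (a := s)
    hτ.continuous.continuousAt (hd _) (hpos _).ne'
    (Filter.Eventually.of_forall fun y => H.apply_symm_apply y)
  rw [one_div]; exact this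

def Fb (m : ℝ) (q : Pt 2) : ℝ := 1 + m * (q 0 ^ 2 + q 1 ^ 2)

def dFb (m : ℝ) (p v : Pt 2) : ℝ := 2 * m * (p 0 * v 0 + p 1 * v 1)

lemma Fb_contDiff (m : ℝ) : ContDiff ℝ (⊤ : ℕ∞) (Fb m) := by
  unfold Fb; fun_prop

lemma Fb_ld (m : ℝ) (p v : Pt 2) : HasLineDerivAt ℝ (Fb m) (dFb m p v) p v := by
  have h0 := hasLD_coord p v 0
  have h1 := hasLD_coord p v 1
  unfold HasLineDerivAt at *
  have := (((h0.pow 2).add (h1.pow 2)).const_mul m).const_add 1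
  convert! this using 1
  simp [dFb]; ring

lemma Fb_fderiv (m : ℝ) (p v : Pt 2) : fderiv ℝ (Fb m) p v = dFb m p v :=
  ((((Fb_contDiff m).differentiable (by simp)) p).hasFDerivAt.hasLineDerivAt v).unique
    (Fb_ld m p v)

lemma base_apply (m : ℝ) (p : Pt 2) (i j : Fin 2) :
    bcvBase m p i j = if i = j then 1 / (Fb m p) ^ 2 else 0 := rfl

lemma base_fderiv (m : ℝ) (p v : Pt 2) (hF : Fb m p ≠ 0) (i j : Fin 2) :
    fderiv ℝ (fun q => bcvBase m q i j) p v =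
      if i = j then -2 * dFb m p v / Fb m p ^ 3 else 0 := by
  simp only [base_apply]
  split_ifs
  · have hd : DifferentiableAt ℝ (fun q => 1 / (Fb m q) ^ 2) p := by
      have := (Fb_contDiff m).differentiable (by simp) p
      simp only [div_eq_mul_inv]
      exact DifferentiableAt.mul (by fun_prop) (DifferentiableAt.inv (by fun_prop) (by positivity))
    refine (hd.hasFDerivAt.hasLineDerivAt v).unique ?_
    have hf := Fb_ld m p v
    unfold HasLineDerivAt at *
    have hF' : Fb m (p + (0:ℝ) • v) ^ 2 ≠ 0 := by simpa using hF
    convert! (hasDerivAt_const (0:ℝ) (1:ℝ)).div (hf.pow 2) hF' using 1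
    simp; field_simp
  · simp

lemma base_det (m : ℝ) (p : Pt 2) (hF : Fb m p ≠ 0) : IsUnit (bcvBase m p).det := by
  have : (bcvBase m p).det = 1 / Fb m p ^ 4 := by
    simp [Matrix.det_fin_two, base_apply]; field_simp
  rw [this, isUnit_iff_ne_zero]; positivity

lemma base_symm (m : ℝ) (p : Pt 2) (i j : Fin 2) : bcvBase m p i j = bcvBase m p j i := by
  simp [base_apply, eq_comm]

lemma base_gip (m : ℝ) (p v w : Pt 2) :
    gip (bcvBase m) p v w = (v 0 * w 0 + v 1 * w 1) / Fb m p ^ 2 := by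
  simp [gip, base_apply]; ring

lemma geod_formula (m : ℝ) (α : ℝ → Pt 2) (hα : ContDiff ℝ (⊤ : ℕ∞) α) (s : ℝ) (C D : ℝ → ℝ)
    (C' D' : ℝ) (hF : Fb m (α s) ≠ 0) (hCD : C s ^ 2 + D s ^ 2 = 1)
    (h0 : ∀ᶠ t in nhds s, deriv α t 0 = Fb m (α t) * C t)
    (h1 : ∀ᶠ t in nhds s, deriv α t 1 = Fb m (α t) * D t)
    (hC : HasDerivAt C C' s) (hD : HasDerivAt D D' s) :
    geodCurv m α s = C s * D' - D s * C' + 2 * m * (C s * α s 1 - D s * α s 0) := by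
  have hFd : HasDerivAt (fun t => Fb m (α t)) (dFb m (α s) (deriv α s)) s := by
    rw [← Fb_fderiv]
    exact (((Fb_contDiff m).differentiable (by simp) _).hasFDerivAt).comp_hasDerivAt s
      ((hα.differentiable (by simp) s).hasDerivAt)
  have e0 : deriv (fun t => deriv α t 0) s = dFb m (α s) (deriv α s) * C s + Fb m (α s) * C' := by
    rw [Filter.EventuallyEq.deriv_eq h0]
    exact (hFd.mul hC).deriv
  have e1 : deriv (fun t => deriv α t 1) s = dFb m (α s) (deriv α s) * D s + Fb m (α s) * D' := by
    rw [Filter.EventuallyEq.deriv_eq h1]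
    exact (hFd.mul hD).deriv
  have v0 := h0.self_of_nhds
  have v1 := h1.self_of_nhds
  unfold geodCurv
  rw [gip_lower _ _ (base_det m _ hF) (base_symm m _)
    (fun k => deriv (fun t => deriv α t k) s), base_gip]
  simp only [dG, base_fderiv m _ _ hF, e0, e1]
  have hD2 : D s ^ 2 = 1 - C s ^ 2 := by linarith
  have hD3 : D s ^ 3 = D s * (1 - C s ^ 2) := by rw [← hD2]; ring
  simp [Fin.sum_univ_two, dFb, v0, v1]
  field_simp
  ring_nf
  simp only [hD2, hD3]
  ring

/-! diffeomorphism of the plane with the domain -/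

def kk (m : ℝ) : ℝ := max (-m) 0

lemma kk_nonneg (m : ℝ) : 0 ≤ kk m := le_max_right _ _

def PhiD (m : ℝ) (z : ℂ) : ℝ := Real.sqrt (1 + kk m * (z.re ^ 2 + z.im ^ 2))

lemma PhiD_arg (m : ℝ) (z : ℂ) : 0 < 1 + kk m * (z.re ^ 2 + z.im ^ 2) := by
  have := kk_nonneg m; positivity

lemma PhiD_pos (m : ℝ) (z : ℂ) : 0 < PhiD m z := Real.sqrt_pos.2 (PhiD_arg m z)

lemma PhiD_sq (m : ℝ) (z : ℂ) : PhiD m z ^ 2 = 1 + kk m * (z.re ^ 2 + z.im ^ 2) :=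
  Real.sq_sqrt (PhiD_arg m z).le

def Phi (m : ℝ) (z : ℂ) : Pt 2 := ![z.re / PhiD m z, z.im / PhiD m z]

def Psi (m : ℝ) (q : Pt 2) : ℂ :=
  ⟨q 0 / Real.sqrt (1 - kk m * (q 0 ^ 2 + q 1 ^ 2)), q 1 / Real.sqrt (1 - kk m * (q 0 ^ 2 + q 1 ^ 2))⟩

lemma Phi_inner (m : ℝ) (z : ℂ) :
    1 - kk m * (Phi m z 0 ^ 2 + Phi m z 1 ^ 2) = (PhiD m z ^ 2)⁻¹ := by
  have h := PhiD_pos m z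
  have h2 := PhiD_sq m z
  simp only [Phi, Matrix.cons_val_zero, Matrix.cons_val_one]
  field_simp
  linarith

lemma inner_pos (m : ℝ) (q : Pt 2) (h : 0 < Fb m q) : 0 < 1 - kk m * (q 0 ^ 2 + q 1 ^ 2) := by
  unfold kk Fb at *
  rcases le_total (-m) 0 with h' | h'
  · rw [max_eq_right h']; simp
  · rw [max_eq_left h']; linarith

lemma Phi_dom (m : ℝ) (z : ℂ) : 0 < Fb m (Phi m z) := by
  have h : 0 < 1 - kk m * (Phi m z 0 ^ 2 + Phi m z 1 ^ 2) := by
    rw [Phi_inner]; have := PhiD_pos m z; positivity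
  unfold Fb
  have : -m ≤ kk m := le_max_left _ _
  nlinarith [sq_nonneg (Phi m z 0), sq_nonneg (Phi m z 1)]

lemma Psi_Phi (m : ℝ) (z : ℂ) : Psi m (Phi m z) = z := by
  have h := PhiD_pos m z
  unfold Psi
  rw [Phi_inner, Real.sqrt_inv, Real.sqrt_sq h.le]
  apply Complex.ext <;> simp [Phi] <;> field_simp

lemma Phi_Psi (m : ℝ) (q : Pt 2) (hq : 0 < Fb m q) : Phi m (Psi m q) = q := by
  have h := inner_pos m q hq
  have hs := Real.sqrt_pos.2 h
  have hsq := Real.sq_sqrt h.le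
  have : PhiD m (Psi m q) = (Real.sqrt (1 - kk m * (q 0 ^ 2 + q 1 ^ 2)))⁻¹ := by
    unfold PhiD
    rw [← Real.sqrt_inv]
    congr 1
    simp only [Psi]
    set S := Real.sqrt (1 - kk m * (q 0 ^ 2 + q 1 ^ 2))
    rw [← hsq]
    field_simp
    linarith
  ext i
  fin_cases i <;> simp [Phi, this] <;> simp [Psi] <;> field_simp

lemma Phi_contDiff (m : ℝ) : ContDiff ℝ (⊤ : ℕ∞) (Phi m) := by
  have hre : ContDiff ℝ (⊤ : ℕ∞) Complex.re := Complex.reCLM.contDiff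
  have him : ContDiff ℝ (⊤ : ℕ∞) Complex.im := Complex.imCLM.contDiff
  have hD : ContDiff ℝ (⊤ : ℕ∞) (PhiD m) := by
    unfold PhiD
    refine ContDiff.sqrt ?_ fun z => (PhiD_arg m z).ne'
    exact contDiff_const.add (contDiff_const.mul ((hre.pow 2).add (him.pow 2)))
  rw [contDiff_pi]
  intro i
  fin_cases i
  · exact hre.div hD fun z => (PhiD_pos m z).ne'
  · exact him.div hD fun z => (PhiD_pos m z).ne'

lemma Psi_contDiffAt (m : ℝ) (q : Pt 2) (hq : 0 < Fb m q) : ContDiffAt ℝ (⊤ : ℕ∞) (Psi m) q := by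
  have h := inner_pos m q hq
  have hs := Real.sqrt_pos.2 h
  have hD : ContDiffAt ℝ (⊤ : ℕ∞)
      (fun q : Pt 2 => Real.sqrt (1 - kk m * (q 0 ^ 2 + q 1 ^ 2))) q := by
    refine ContDiffAt.sqrt ?_ h.ne'
    fun_prop
  have h0 : ContDiffAt ℝ (⊤ : ℕ∞) (fun q : Pt 2 => q 0) q := by fun_prop
  have h1 : ContDiffAt ℝ (⊤ : ℕ∞) (fun q : Pt 2 => q 1) q := by fun_prop
  have e : Psi m = fun q => Complex.equivRealProdCLM.symm
      (q 0 / Real.sqrt (1 - kk m * (q 0 ^ 2 + q 1 ^ 2)),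
       q 1 / Real.sqrt (1 - kk m * (q 0 ^ 2 + q 1 ^ 2))) := by
    funext q; apply Complex.ext <;> simp [Psi]
  rw [e]
  exact Complex.equivRealProdCLM.symm.contDiff.contDiffAt.comp q
    ((h0.div hD hs.ne').prodMk (h1.div hD hs.ne'))

def GoodArc (m : ℝ) (β : ℝ → Pt 2) (ε : ℝ) : Prop :=
  0 < ε ∧ ε ≤ 1 / 2 ∧ ∃ θ : ℝ, -Real.pi < θ ∧ θ ≤ Real.pi ∧ ∀ t, |t| < 3 * ε →
    ContDiffAt ℝ (⊤ : ℕ∞) (Psi m ∘ β) t ∧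
    0 < (deriv (Psi m ∘ β) t * ex (-(θ + t))).im ∧ 0 < Fb m (β t)

lemma prep (m : ℝ) (β : ℝ → Pt 2) (hβ : ∀ᶠ t in nhds (0:ℝ), ContDiffAt ℝ (⊤ : ℕ∞) β t)
    (hF : 0 < Fb m (β 0)) (hd : deriv β 0 ≠ 0) (δ : ℝ) (hδ : 0 < δ) :
    ∃ ε, ε ≤ δ ∧ GoodArc m β ε := by
  have hβ0 := hβ.self_of_nhds
  have hFe : ∀ᶠ t in nhds (0:ℝ), 0 < Fb m (β t) :=
    ((Fb_contDiff m).continuous.continuousAt.comp hβ0.continuousAt).eventually (lt_mem_nhds hF)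
  have hc : ∀ᶠ t in nhds (0:ℝ), ContDiffAt ℝ (⊤ : ℕ∞) (Psi m ∘ β) t := by
    filter_upwards [hβ, hFe] with t h1 h2
    exact (Psi_contDiffAt m _ h2).comp t h1
  have hc0 := hc.self_of_nhds
  have hne : deriv (Psi m ∘ β) 0 ≠ 0 := by
    intro h0
    apply hd
    have h1 : HasDerivAt (Psi m ∘ β) 0 0 := by
      rw [← h0]; exact (hc0.differentiableAt (by simp)).hasDerivAt
    have h2 := (((Phi_contDiff m).differentiable (by simp) _).hasFDerivAt).comp_hasDerivAt (0:ℝ) h1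
    have h3 : β =ᶠ[nhds 0] (Phi m ∘ (Psi m ∘ β)) := by
      filter_upwards [hFe] with t ht
      simp [Phi_Psi m _ ht]
    have := (h2.congr_of_eventuallyEq h3).deriv
    simpa using this
  have hdc : ContinuousAt (deriv (Psi m ∘ β)) 0 := by
    have h := (hc0.fderiv_right (m := 0) (by simp)).continuousAt
    have e : deriv (Psi m ∘ β) = fun t => fderiv ℝ (Psi m ∘ β) t 1 := rfl
    rw [e]
    exact h.clm_apply continuousAt_const
  set c' := deriv (Psi m ∘ β) 0 with hc'
  let θ := Complex.arg (c' / Complex.I)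
  have hpos : 0 < (c' * ex (-(θ + 0))).im := by
    have h1 := Complex.norm_mul_exp_arg_mul_I (c' / Complex.I)
    have h2 : c' = ‖c' / Complex.I‖ * ex θ * Complex.I := by
      unfold ex; rw [h1]; field_simp
    have h3 : c' * ex (-(θ + 0)) = ‖c' / Complex.I‖ * Complex.I := by
      have := ex_neg_mul θ
      rw [add_zero]
      calc c' * ex (-θ) = (‖c' / Complex.I‖ * ex θ * Complex.I) * ex (-θ) := by rw [← h2]
        _ = ‖c' / Complex.I‖ * Complex.I * (ex θ * ex (-θ)) := by ring
        _ = _ := by rw [this, mul_one]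
    rw [h3]
    simp
    exact hne
  have hcont : ContinuousAt (fun t => (deriv (Psi m ∘ β) t * ex (-(θ + t))).im) 0 := by
    have hex := ex_contDiff.continuous
    apply Complex.continuous_im.continuousAt.comp
    exact hdc.mul (by fun_prop)
  have hev := hc.and ((hcont.eventually (lt_mem_nhds hpos)).and hFe)
  obtain ⟨r, hr, hr'⟩ := Metric.eventually_nhds_iff.1 hev
  refine ⟨min (r / 3) (min δ (1 / 2)), ?_, ?_, ?_, θ, Complex.neg_pi_lt_arg _,
    Complex.arg_le_pi _, ?_⟩
  · exact (min_le_right _ _).trans (min_le_left _ _)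
  · positivity
  · exact (min_le_right _ _).trans (min_le_right _ _)
  · intro t ht
    apply hr'
    rw [Real.dist_eq, sub_zero]
    have := min_le_left (r / 3) (min δ (1 / 2))
    linarith

lemma base_curve (m : ℝ) (β : ℕ → ℝ → Pt 2) (ε : ℕ → ℝ) (h : ∀ n, GoodArc m (β n) (ε n)) :
    ∃ α : ℝ → Pt 2, ContDiff ℝ (⊤ : ℕ∞) α ∧ (∀ s, 0 < Fb m (α s)) ∧
      (∀ s, gip (bcvBase m) (α s) (deriv α s) (deriv α s) = 1) ∧
      ∀ n t, |t| < ε n → ∃ (s : ℝ) (τ : ℝ → ℝ), τ s = t ∧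
        (∀ᶠ s' in nhds s, α s' = β n (τ s')) ∧ ∀ s', ∃ d > 0, HasDerivAt τ d s' := by
  have hpi := Real.pi_gt_three
  choose hε hε1 θ hθ1 hθ2 hA using h
  have hblock : ∀ n : ℕ, ∃ g : ℝ → ℂ, ContDiff ℝ (⊤ : ℕ∞) g ∧ (∀ t, deriv g t ≠ 0) ∧
      (∀ t ≤ 1, g t = ex t) ∧ (∀ t ≥ 13 * Real.pi, g t = ex t) ∧
      ∀ t, |t| ≤ ε n → g (θ n + 6 * Real.pi + t) = (Psi m ∘ β n) t := fun n =>
    block _ (θ n) (ε n) (hθ1 n) (hθ2 n) (hε n) (hε1 n) (fun t ht => (hA n t ht).1)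
      (fun t ht => (hA n t ht).2.1)
  choose g hg hg' hL hR hgc using hblock
  obtain ⟨γ, hγ, hγ', hγg⟩ := chain (fun n => g n.natAbs) (fun n => hg _) (fun n => hg' _)
    (fun n => hL _) (fun n => hR _)
  let δ : ℝ → Pt 2 := Phi m ∘ γ
  have hδ : ContDiff ℝ (⊤ : ℕ∞) δ := (Phi_contDiff m).comp hγ
  have hδF : ∀ t, 0 < Fb m (δ t) := fun t => Phi_dom m _
  have hδd : ∀ t, HasDerivAt δ (deriv δ t) t := fun t =>
    (hδ.differentiable (by simp) t).hasDerivAt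
  have hδ' : ∀ t, deriv δ t ≠ 0 := by
    intro t h0
    apply hγ' t
    have h1 := hδd t
    rw [h0] at h1
    have h2 := (((Psi_contDiffAt m _ (hδF t)).differentiableAt (by simp)).hasFDerivAt).comp_hasDerivAt
      t h1
    have h3 : Psi m ∘ δ = γ := by funext t; simp [δ, Psi_Phi]
    rw [h3] at h2
    simpa using h2.deriv
  have hdsm : ContDiff ℝ (⊤ : ℕ∞) (deriv δ) := (contDiff_infty_iff_deriv.1 hδ).2
  have hcomp : ∀ i, ContDiff ℝ (⊤ : ℕ∞) (fun t => deriv δ t i) := fun i => contDiff_pi.1 hdsm i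
  let N : ℝ → ℝ := fun t => deriv δ t 0 ^ 2 + deriv δ t 1 ^ 2
  have hN : ∀ t, 0 < N t := by
    intro t
    rcases eq_or_ne (deriv δ t 0) 0 with h0 | h0
    · have h1 : deriv δ t 1 ≠ 0 := by
        intro h1
        apply hδ' t
        ext i; fin_cases i
        · exact h0
        · exact h1
      simp only [N]; positivity
    · simp only [N]; positivity
  let ρ : ℝ → ℝ := fun t => Real.sqrt (N t) / Fb m (δ t)
  have hNs : ContDiff ℝ (⊤ : ℕ∞) N := ((hcomp 0).pow 2).add ((hcomp 1).pow 2)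
  have hρ : ContDiff ℝ (⊤ : ℕ∞) ρ :=
    (hNs.sqrt fun t => (hN t).ne').div ((Fb_contDiff m).comp hδ) fun t => (hδF t).ne'
  have hρp : ∀ t, 0 < ρ t := fun t => div_pos (Real.sqrt_pos.2 (hN t)) (hδF t)
  have hperγ : ∀ (n : ℤ) (t : ℝ), |t| ≤ 1 → γ (14 * Real.pi * n + t) = γ t := by
    intro n t ht
    obtain ⟨h1, h2⟩ := abs_le.1 ht
    rw [hγg n t h1 (by linarith), hL _ t h2]
    have := hγg 0 t h1 (by linarith)
    rw [hL _ t h2] at this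
    simpa using this.symm
  have hper : ∀ (n : ℤ) (t : ℝ), |t| ≤ 1 / 2 → ρ (14 * Real.pi * n + t) = ρ t := by
    intro n t ht
    have e1 : δ (14 * Real.pi * n + t) = δ t := by
      simp only [δ, Function.comp]; rw [hperγ n t (by linarith)]
    have e2 : deriv δ (14 * Real.pi * n + t) = deriv δ t := by
      rw [← deriv_comp_const_add]
      apply Filter.EventuallyEq.deriv_eq
      have : ∀ᶠ x in nhds t, |x| < 1 :=
        continuous_abs.continuousAt.eventually (gt_mem_nhds (by linarith))
      filter_upwards [this] with x hx
      simp only [δ, Function.comp]; rw [hperγ n x hx.le]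
    simp only [ρ, N, e1, e2]
  obtain ⟨τ, σ, hτ, hτσ, hτd⟩ := reparam ρ hρ hρp (14 * Real.pi) (by linarith) hper
  have hαd : ∀ s, HasDerivAt (δ ∘ τ) ((1 / ρ (τ s)) • deriv δ (τ s)) s := fun s =>
    (hδd (τ s)).scomp s (hτd s)
  refine ⟨δ ∘ τ, hδ.comp hτ, fun s => hδF _, ?_, ?_⟩
  · intro s
    rw [(hαd s).deriv, base_gip]
    have h1 := hδF (τ s)
    have h2 := Real.sqrt_pos.2 (hN (τ s))
    have h3 := Real.sq_sqrt (hN (τ s)).le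
    simp only [Pi.smul_apply, smul_eq_mul, Function.comp, ρ]
    have h4 : deriv δ (τ s) 0 ^ 2 + deriv δ (τ s) 1 ^ 2 = N (τ s) := rfl
    field_simp
    rw [h3, ← h4]
  · intro n t ht
    obtain ⟨ht1, ht2⟩ := abs_lt.1 ht
    have a1 := hθ1 n
    have a2 := hθ2 n
    have a3 := hε1 n
    let x0 : ℝ := 14 * Real.pi * (n : ℤ) + (θ n + 6 * Real.pi)
    refine ⟨σ (x0 + t), fun s => τ s - x0, ?_, ?_, ?_⟩
    · simp [hτσ]
    · have hcont : ContinuousAt (fun s => |τ s - x0|) (σ (x0 + t)) := by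
        have := hτ.continuous; fun_prop
      have : ∀ᶠ s' in nhds (σ (x0 + t)), |τ s' - x0| < ε n := by
        apply hcont.eventually (gt_mem_nhds _)
        simpa [hτσ] using ht
      filter_upwards [this] with s' hs'
      obtain ⟨hs1, hs2⟩ := abs_lt.1 hs'
      have e : γ (τ s') = (Psi m ∘ β n) (τ s' - x0) := by
        rw [← hgc n _ hs'.le]
        have := hγg n (θ n + 6 * Real.pi + (τ s' - x0)) (by linarith) (by linarith)
        rw [Int.natAbs_natCast] at this
        rw [← this]
        congr 1
        simp only [x0]; ring
      simp only [δ, Function.comp]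
      rw [e]
      exact Phi_Psi m _ (hA n _ (by linarith [hε n])).2.2
    · intro s'
      exact ⟨1 / ρ (τ s'), one_div_pos.2 (hρp _), (hτd s').sub_const _⟩

lemma span_two (w v1 v : Pt 2) (X Y Z : Pt 2 →L[ℝ] ℝ) (f a b : ℝ) (hf : 0 < f)
    (hab : a ^ 2 + b ^ 2 = 1) (hX1 : X v1 = f * a) (hY1 : Y v1 = f * b) (hX2 : X w = 0)
    (hY2 : Y w = 0) (hZ : Z w = 1) : ∃ c d : ℝ, v = c • v1 + d • w := by
  have hD : v1 0 * w 1 - v1 1 * w 0 ≠ 0 := by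
    intro h
    have k : ∀ i, w i = 0 := by
      intro i
      have e : w i • v1 - v1 i • w = 0 := by
        ext j; fin_cases i <;> fin_cases j <;> simp <;> linarith
      have e1 := congrArg X e
      have e2 := congrArg Y e
      simp [hX1, hX2, hY1, hY2, hf.ne'] at e1 e2
      by_contra hne
      rcases e1 with e1 | e1
      · exact hne e1
      rcases e2 with e2 | e2
      · exact hne e2
      simp [e1, e2] at hab
    have : w = 0 := funext k
    simp [this] at hZ
  refine ⟨(v 0 * w 1 - v 1 * w 0) / (v1 0 * w 1 - v1 1 * w 0),
    (v1 0 * v 1 - v1 1 * v 0) / (v1 0 * w 1 - v1 1 * w 0), ?_⟩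
  ext i; fin_cases i <;> simp <;>
    rw [div_mul_eq_mul_div, div_mul_eq_mul_div, ← add_div, eq_div_iff hD] <;> ring

lemma arc (x y z a b F : Pt 2 → ℝ) (w₁ w₂ : Pt 2 → Pt 2)
    (hx : ContDiff ℝ (⊤ : ℕ∞) x) (hy : ContDiff ℝ (⊤ : ℕ∞) y) (hz : ContDiff ℝ (⊤ : ℕ∞) z)
    (ha : ContDiff ℝ (⊤ : ℕ∞) a) (hb : ContDiff ℝ (⊤ : ℕ∞) b)
    (hF : ∀ u, 0 < F u) (hab : ∀ u, a u ^ 2 + b u ^ 2 = 1)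
    (hx1 : ∀ u, fderiv ℝ x u (w₁ u) = F u * a u) (hy1 : ∀ u, fderiv ℝ y u (w₁ u) = F u * b u)
    (hx2 : ∀ u, fderiv ℝ x u (w₂ u) = 0) (hy2 : ∀ u, fderiv ℝ y u (w₂ u) = 0)
    (hz2 : ∀ u, fderiv ℝ z u (w₂ u) = 1) (u0 : Pt 2) :
    ∃ U ∈ nhds u0, ∃ (T : Pt 2 → ℝ) (η : ℝ → Pt 2) (r : ℝ), 0 < r ∧ Continuous T ∧ T u0 = 0 ∧
      (∀ t, |t| < r → ContDiffAt ℝ (⊤ : ℕ∞) η t ∧ η t ∈ U ∧ T (η t) = t) ∧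
      ∀ u ∈ U, |T u| < r ∧ ∃ k > 0, ∀ f : Pt 2 → ℝ, ContDiff ℝ (⊤ : ℕ∞) f →
        (∀ u, fderiv ℝ f u (w₂ u) = 0) →
        f (η (T u)) = f u ∧ HasDerivAt (fun t => f (η t)) (-(fderiv ℝ f u (w₁ u)) / k) (T u) := by
  set a0 := a u0
  set b0 := b u0
  let p : Pt 2 → ℝ := fun u => a0 * x u + b0 * y u
  have hp : ContDiff ℝ (⊤ : ℕ∞) p := (contDiff_const.mul hx).add (contDiff_const.mul hy)
  let Θ : Pt 2 → ℝ × ℝ := fun u => (p u, z u)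
  have hΘ : ContDiff ℝ (⊤ : ℕ∞) Θ := hp.prodMk hz
  have hpd : ∀ u v, fderiv ℝ p u v = a0 * fderiv ℝ x u v + b0 * fderiv ℝ y u v := by
    intro u v
    have h1 := (hx.differentiable (by simp) u).hasFDerivAt.const_mul a0
    have h2 := (hy.differentiable (by simp) u).hasFDerivAt.const_mul b0
    have h3 : HasFDerivAt p _ u := h1.add h2
    rw [h3.fderiv]; simp
  have hΘd : ∀ u, HasFDerivAt Θ ((fderiv ℝ p u).prod (fderiv ℝ z u)) u := fun u =>
    (hp.differentiable (by simp) u).hasFDerivAt.prodMk (hz.differentiable (by simp) u).hasFDerivAt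
  let W : Pt 2 → ℝ := fun u => a u * a0 + b u * b0
  have hWc : Continuous W := by
    have := ha.continuous; have := hb.continuous; fun_prop
  have hp1 : ∀ u, fderiv ℝ p u (w₁ u) = F u * W u := by
    intro u; rw [hpd, hx1, hy1]; simp only [W]; ring
  have hp2 : ∀ u, fderiv ℝ p u (w₂ u) = 0 := by
    intro u; rw [hpd, hx2, hy2]; ring
  have hspan : ∀ u v, ∃ c d : ℝ, v = c • w₁ u + d • w₂ u := fun u v =>
    span_two (w₂ u) (w₁ u) v _ _ _ (F u) (a u) (b u) (hF u) (hab u) (hx1 u) (hy1 u) (hx2 u)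
      (hy2 u) (hz2 u)
  have hequiv : ∀ u, 0 < W u → ∃ L : Pt 2 ≃L[ℝ] ℝ × ℝ,
      (L : Pt 2 →L[ℝ] ℝ × ℝ) = (fderiv ℝ p u).prod (fderiv ℝ z u) := by
    intro u hW
    have hinj : Function.Injective ((fderiv ℝ p u).prod (fderiv ℝ z u)).toLinearMap := by
      rw [← LinearMap.ker_eq_bot, LinearMap.ker_eq_bot']
      intro v hv
      obtain ⟨c, d, rfl⟩ := hspan u v
      simp [hp1, hp2, hz2, (hF u).ne', hW.ne'] at hv
      obtain ⟨h1, h2⟩ := hv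
      simp [h1] at h2
      simp [h1, h2]
    let e := LinearEquiv.ofInjectiveOfFinrankEq _ hinj (by simp)
    refine ⟨e.toContinuousLinearEquiv, ?_⟩
    ext v <;> rfl
  have hW0 : 0 < W u0 := by
    have := hab u0
    simp only [W, a0, b0]; nlinarith
  obtain ⟨L0, hL0⟩ := hequiv u0 hW0
  let e := hΘ.contDiffAt.toOpenPartialHomeomorph Θ (hL0 ▸ hΘd u0) (by simp)
  have hecoe : (e : Pt 2 → ℝ × ℝ) = Θ := rfl
  have hu0 : u0 ∈ e.source := hΘ.contDiffAt.mem_toOpenPartialHomeomorph_source (hL0 ▸ hΘd u0) (by simp)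
  have hWo : IsOpen {u | 0 < W u} := isOpen_lt continuous_const hWc
  have hVo : IsOpen (e '' (e.source ∩ {u | 0 < W u})) :=
    e.isOpen_image_of_subset_source (e.open_source.inter hWo) Set.inter_subset_left
  obtain ⟨r, hr, hball⟩ := Metric.isOpen_iff.1 hVo (Θ u0) ⟨u0, ⟨hu0, hW0⟩, rfl⟩
  have hbox : ∀ q s : ℝ, |q - p u0| < r → |s - z u0| < r →
      (q, s) ∈ e.target ∧ e.symm (q, s) ∈ e.source ∧ 0 < W (e.symm (q, s)) ∧
        Θ (e.symm (q, s)) = (q, s) := by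
    intro q s hq hs
    have : (q, s) ∈ Metric.ball (Θ u0) r := by
      rw [Metric.mem_ball, Prod.dist_eq, max_lt_iff, Real.dist_eq, Real.dist_eq]
      exact ⟨hq, hs⟩
    obtain ⟨u, ⟨h1, h2⟩, h3⟩ := hball this
    rw [← h3]
    rw [e.left_inv h1]
    exact ⟨e.map_source h1, h1, h2, rfl⟩
  let G : ℝ × ℝ → Pt 2 := e.symm
  have hGs : ∀ q s : ℝ, |q - p u0| < r → |s - z u0| < r → ContDiffAt ℝ (⊤ : ℕ∞) G (q, s) := by
    intro q s hq hs
    obtain ⟨h1, h2, h3, h4⟩ := hbox q s hq hs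
    obtain ⟨L, hL⟩ := hequiv _ h3
    exact e.contDiffAt_symm h1 (f₀' := L) (by rw [hL]; exact hΘd _) hΘ.contDiffAt
  have hGd : ∀ q s : ℝ, |q - p u0| < r → |s - z u0| < r → ∀ v : ℝ × ℝ, ∃ c d : ℝ,
      fderiv ℝ G (q, s) v = c • w₁ (G (q, s)) + d • w₂ (G (q, s)) ∧
      c * (F (G (q, s)) * W (G (q, s))) = v.1 := by
    intro q s hq hs v
    obtain ⟨h1, h2, h3, h4⟩ := hbox q s hq hs
    obtain ⟨c, d, hcd⟩ := hspan (G (q, s)) (fderiv ℝ G (q, s) v)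
    refine ⟨c, d, hcd, ?_⟩
    have hd := (hΘd (G (q, s))).comp (q, s) ((hGs q s hq hs).differentiableAt (by simp)).hasFDerivAt
    have hid : Θ ∘ G =ᶠ[nhds (q, s)] id := by
      filter_upwards [e.open_target.mem_nhds h1] with w hw
      exact e.right_inv hw
    have hu := (hd.congr_of_eventuallyEq hid.symm).unique (hasFDerivAt_id (q, s))
    have hv := congrArg (fun M : ℝ × ℝ →L[ℝ] ℝ × ℝ => (M v).1) hu
    simp [hcd, hp1, hp2] at hv
    exact hv
  have hconst : ∀ f : Pt 2 → ℝ, ContDiff ℝ (⊤ : ℕ∞) f → (∀ u, fderiv ℝ f u (w₂ u) = 0) →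
      ∀ q s s' : ℝ, |q - p u0| < r → |s - z u0| < r → |s' - z u0| < r →
        f (G (q, s)) = f (G (q, s')) := by
    intro f hf hf2 q s s' hq hs hs'
    have hconv : Convex ℝ (Metric.ball (z u0) r) := convex_ball _ _
    have hder : ∀ t ∈ Metric.ball (z u0) r, HasDerivWithinAt (fun t => f (G (q, t))) 0
        (Metric.ball (z u0) r) t := by
      intro t ht
      rw [Metric.mem_ball, Real.dist_eq] at ht
      have hg := ((hGs q t hq ht).differentiableAt (by simp)).hasFDerivAt
      have hl : HasDerivAt (fun t : ℝ => (q, t)) ((0:ℝ), (1:ℝ)) t :=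
        (hasDerivAt_const t q).prodMk (hasDerivAt_id t)
      have h1 := hg.comp_hasDerivAt t hl
      have h2 := ((hf.differentiable (by simp) _).hasFDerivAt).comp_hasDerivAt t h1
      obtain ⟨c, d, hcd, hc⟩ := hGd q t hq ht (0, 1)
      obtain ⟨_, _, h3, _⟩ := hbox q t hq ht
      have hc0 : c = 0 := by
        have := hF (G (q, t))
        have h3' : 0 < W (G (q, t)) := h3
        rcases mul_eq_zero.1 hc with h | h
        · exact h
        · exact absurd h (by positivity)
      rw [hcd, hc0] at h2
      simp [hf2] at h2
      exact h2.hasDerivWithinAt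
    have := hconv.norm_image_sub_le_of_norm_hasDerivWithin_le (C := 0) hder (by simp)
      (x := s') (y := s) (by rwa [Metric.mem_ball, Real.dist_eq])
      (by rwa [Metric.mem_ball, Real.dist_eq])
    simpa [sub_eq_zero] using this
  have hz0 : |z u0 - z u0| < r := by simpa using hr
  let T : Pt 2 → ℝ := fun u => p u0 - p u
  have hpc := hp.continuous
  have hzc := hz.continuous
  have hTc : Continuous T := by fun_prop
  let U : Set (Pt 2) := {u | u ∈ e.source ∧ |T u| < r ∧ |z u - z u0| < r}
  refine ⟨U, ?_, T, fun t => G (p u0 - t, z u0), r, hr, hTc, by simp [T], ?_, ?_⟩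
  · have h2 : ∀ᶠ u in nhds u0, |T u| < r :=
      (hTc.abs.continuousAt (x := u0)).eventually (gt_mem_nhds (by simpa [T] using hr))
    have h3 : ∀ᶠ u in nhds u0, |z u - z u0| < r :=
      ((hzc.sub continuous_const).abs.continuousAt (x := u0)).eventually
        (gt_mem_nhds (by simpa using hr))
    filter_upwards [e.open_source.mem_nhds hu0, h2, h3] with u a1 a2 a3
    exact ⟨a1, a2, a3⟩
  · intro t ht
    have hq : |(p u0 - t) - p u0| < r := by simpa using ht
    obtain ⟨h1, h2, h3, h4⟩ := hbox _ _ hq hz0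
    have hp' : p (e.symm (p u0 - t, z u0)) = p u0 - t := congrArg Prod.fst h4
    have hz' : z (e.symm (p u0 - t, z u0)) = z u0 := congrArg Prod.snd h4
    have hT : T (e.symm (p u0 - t, z u0)) = t := by simp only [T]; rw [hp']; ring
    refine ⟨?_, ⟨h2, ?_, ?_⟩, hT⟩
    · exact (hGs _ _ hq hz0).comp t (by fun_prop)
    · show |T (e.symm (p u0 - t, z u0))| < r
      rw [hT]; exact ht
    · show |z (e.symm (p u0 - t, z u0)) - z u0| < r
      rw [hz']; exact hz0
  · rintro u ⟨hus, huT, huz⟩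
    refine ⟨huT, ?_⟩
    have hpu : |p u - p u0| < r := by rw [abs_sub_comm]; exact huT
    have hGu : G (p u, z u) = u := e.left_inv hus
    have hTu : p u0 - T u = p u := by simp [T]
    obtain ⟨_, _, hWu, _⟩ := hbox _ _ hpu huz
    have hWu : 0 < W u := by rw [← hGu]; exact hWu
    refine ⟨F u * W u, mul_pos (hF u) hWu, fun f hf hf2 => ⟨?_, ?_⟩⟩
    · show f (G (p u0 - T u, z u0)) = f u
      rw [hTu, hconst f hf hf2 _ _ (z u) hpu hz0 huz, hGu]
    · have hev : (fun t => f (G (p u0 - t, z u0))) =ᶠ[nhds (T u)]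
          fun t => f (G (p u0 - t, z u)) := by
        have : ∀ᶠ t in nhds (T u), |t| < r := continuous_abs.continuousAt.eventually (gt_mem_nhds huT)
        filter_upwards [this] with t ht
        exact hconst f hf hf2 _ _ _ (by simpa using ht) hz0 huz
      refine HasDerivAt.congr_of_eventuallyEq ?_ hev
      have hg := ((hGs _ _ hpu huz).differentiableAt (by simp)).hasFDerivAt
      rw [← hTu] at hg
      have hl : HasDerivAt (fun t : ℝ => (p u0 - t, z u)) ((-1:ℝ), (0:ℝ)) (T u) :=
        ((hasDerivAt_id (T u)).const_sub (p u0)).prodMk (hasDerivAt_const _ _)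
      have h1 := hg.comp_hasDerivAt (T u) hl
      have h2 := ((hf.differentiable (by simp) _).hasFDerivAt).comp_hasDerivAt (T u) h1
      obtain ⟨c, d, hcd, hc⟩ := hGd _ _ hpu huz (-1, 0)
      simp only [Function.comp, hTu, hcd, hGu] at h2
      rw [hGu] at hc
      convert! h2 using 1
      have := hF u
      simp [hf2]
      field_simp
      linear_combination (-fderiv ℝ f u (w₁ u)) * hc

lemma curve_part (m : ℝ) (x y z a b : Pt 2 → ℝ) (w₁ w₂ : Pt 2 → Pt 2)
    (hx : ContDiff ℝ (⊤ : ℕ∞) x) (hy : ContDiff ℝ (⊤ : ℕ∞) y) (hz : ContDiff ℝ (⊤ : ℕ∞) z)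
    (ha : ContDiff ℝ (⊤ : ℕ∞) a) (hb : ContDiff ℝ (⊤ : ℕ∞) b)
    (hF : ∀ u, 0 < 1 + m * (x u ^ 2 + y u ^ 2)) (hab : ∀ u, a u ^ 2 + b u ^ 2 = 1)
    (hx1 : ∀ u, fderiv ℝ x u (w₁ u) = (1 + m * (x u ^ 2 + y u ^ 2)) * a u)
    (hy1 : ∀ u, fderiv ℝ y u (w₁ u) = (1 + m * (x u ^ 2 + y u ^ 2)) * b u)
    (hx2 : ∀ u, fderiv ℝ x u (w₂ u) = 0) (hy2 : ∀ u, fderiv ℝ y u (w₂ u) = 0)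
    (hz2 : ∀ u, fderiv ℝ z u (w₂ u) = 1)
    (ha2 : ∀ u, fderiv ℝ a u (w₂ u) = 0) (hb2 : ∀ u, fderiv ℝ b u (w₂ u) = 0) :
    ∃ α : ℝ → Pt 2, ContDiff ℝ (⊤ : ℕ∞) α ∧
      (∀ s, gip (bcvBase m) (α s) (deriv α s) (deriv α s) = 1) ∧
      ∀ u, ∃ s, α s 0 = x u ∧ α s 1 = y u ∧
        geodCurv m α s = -(a u * fderiv ℝ b u (w₁ u) - b u * fderiv ℝ a u (w₁ u)
          + 2 * m * (a u * y u - b u * x u)) := by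
  have harc := arc x y z a b _ w₁ w₂ hx hy hz ha hb hF hab hx1 hy1 hx2 hy2 hz2
  choose U hU T η r hr hTc hT0 hη hUf using harc
  let β : Pt 2 → ℝ → Pt 2 := fun v t => ![x (η v t), y (η v t)]
  have hβF : ∀ v t, 0 < Fb m (β v t) := fun v t => hF _
  have hβd : ∀ v, ∀ u ∈ U v, ∃ k > 0,
      HasDerivAt (β v) ![-((1 + m * (x u ^ 2 + y u ^ 2)) * a u) / k,
        -((1 + m * (x u ^ 2 + y u ^ 2)) * b u) / k] (T v u) ∧
      β v (T v u) = ![x u, y u] ∧ a (η v (T v u)) = a u ∧ b (η v (T v u)) = b u ∧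
      HasDerivAt (fun t => a (η v t)) (-(fderiv ℝ a u (w₁ u)) / k) (T v u) ∧
      HasDerivAt (fun t => b (η v t)) (-(fderiv ℝ b u (w₁ u)) / k) (T v u) := by
    intro v u hu
    obtain ⟨_, k, hk, hf⟩ := hUf v u hu
    have fx := hf x hx hx2
    have fy := hf y hy hy2
    have fa := hf a ha ha2
    have fb := hf b hb hb2
    refine ⟨k, hk, ?_, ?_, fa.1, fb.1, fa.2, fb.2⟩
    · rw [hasDerivAt_pi]
      intro i; fin_cases i
      · have := fx.2; rw [hx1] at this; exact this
      · have := fy.2; rw [hy1] at this; exact this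
    · simp only [β]; rw [fx.1, fy.1]
  have hgood : ∀ v, ∃ ε, ε ≤ r v ∧ GoodArc m (β v) ε := by
    intro v
    refine prep m (β v) ?_ (hβF v 0) ?_ (r v) (hr v)
    · have : ∀ᶠ t in nhds (0:ℝ), |t| < r v :=
        continuous_abs.continuousAt.eventually (gt_mem_nhds (by simpa using hr v))
      filter_upwards [this] with t ht
      have h := (hη v t ht).1
      rw [contDiffAt_pi]
      intro i; fin_cases i
      · exact hx.contDiffAt.comp t h
      · exact hy.contDiffAt.comp t h
    · obtain ⟨k, hk, h, _⟩ := hβd v v (mem_of_mem_nhds (hU v))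
      rw [hT0] at h
      rw [h.deriv]
      intro h0
      have e0 := congrFun h0 0
      have e1 := congrFun h0 1
      simp [hk.ne', (hF v).ne'] at e0 e1
      have := hab v
      simp [e0, e1] at this
  choose ε hεr hε using hgood
  have hcov : ∀ v, {u | u ∈ U v ∧ |T v u| < ε v} ∈ nhds v := by
    intro v
    have : ∀ᶠ u in nhds v, |T v u| < ε v :=
      ((hTc v).abs.continuousAt (x := v)).eventually
        (gt_mem_nhds (by simpa [hT0] using (hε v).1))
    exact Filter.inter_mem (hU v) this
  obtain ⟨S, hSc, hS⟩ := TopologicalSpace.countable_cover_nhds hcov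
  have hSne : S.Nonempty := by
    by_contra hne
    rw [Set.not_nonempty_iff_eq_empty] at hne
    subst hne
    have : (0 : Pt 2) ∈ (Set.univ : Set (Pt 2)) := Set.mem_univ _
    rw [← hS] at this
    simp at this
  obtain ⟨V, rfl⟩ := hSc.exists_eq_range hSne
  obtain ⟨α, hα, hαF, hαu, hαn⟩ := base_curve m (fun n => β (V n)) (fun n => ε (V n))
    (fun n => hε _)
  refine ⟨α, hα, hαu, fun u => ?_⟩
  have hu : u ∈ (Set.univ : Set (Pt 2)) := Set.mem_univ _
  rw [← hS] at hu
  simp only [Set.mem_iUnion, Set.mem_range, exists_prop, exists_exists_eq_and] at hu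
  obtain ⟨n, huU, huT⟩ := hu
  obtain ⟨s, τ, hτs, hατ, hτd⟩ := hαn n _ huT
  set v := V n
  have key : ∀ (s' d : ℝ), HasDerivAt τ d s' → 0 < d → (∀ᶠ s'' in nhds s', α s'' = β v (τ s'')) →
      ∀ u' ∈ U v, ∀ k > 0, T v u' = τ s' → HasDerivAt (β v) ![-((1 + m * (x u' ^ 2 + y u' ^ 2)) * a u') / k,
        -((1 + m * (x u' ^ 2 + y u' ^ 2)) * b u') / k] (T v u') → β v (T v u') = ![x u', y u'] →
      d = k ∧ deriv α s' 0 = -(Fb m (α s') * a u') ∧ deriv α s' 1 = -(Fb m (α s') * b u') := by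
    intro s' d hd hd0 hev u' hu' k hk hT hβ' hβv
    rw [hT] at hβ' hβv
    have h1 := (hβ'.scomp s' hd).congr_of_eventuallyEq hev
    have hFe : Fb m (α s') = 1 + m * (x u' ^ 2 + y u' ^ 2) := by
      rw [hev.self_of_nhds, hβv]; rfl
    have hF0 := hF u'
    have hu1 := hαu s'
    rw [base_gip, h1.deriv, hFe] at hu1
    rw [h1.deriv, hFe]
    set f := 1 + m * (x u' ^ 2 + y u' ^ 2)
    have h3 := hab u'
    simp at hu1 ⊢
    have hdk : d = k := by
      field_simp at hu1
      have : d ^ 2 = k ^ 2 := by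
        linear_combination hu1 - d ^ 2 * h3
      exact (pow_left_inj₀ hd0.le hk.le two_ne_zero).1 this
    refine ⟨hdk, ?_, ?_⟩ <;> rw [hdk] <;> field_simp
  obtain ⟨k, hk, g1, g2, g3, g4, g5, g6⟩ := hβd v u huU
  obtain ⟨d, hd0, hd⟩ := hτd s
  obtain ⟨hdk, _, _⟩ := key s d hd hd0 hατ u huU k hk hτs.symm g1 g2
  have hαs : α s = ![x u, y u] := by rw [hατ.self_of_nhds, hτs]; exact g2
  refine ⟨s, by rw [hαs]; rfl, by rw [hαs]; rfl, ?_⟩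
  have hnear : ∀ᶠ s' in nhds s, deriv α s' 0 = Fb m (α s') * (-(a (η v (τ s')))) ∧
      deriv α s' 1 = Fb m (α s') * (-(b (η v (τ s')))) := by
    have hc : ContinuousAt (fun s' => |τ s'|) s := hd.continuousAt.abs
    have hlt : ∀ᶠ s' in nhds s, |τ s'| < r v :=
      hc.eventually (gt_mem_nhds (by simp only [hτs]; exact huT.trans_le (hεr v)))
    filter_upwards [hlt, hατ.eventually_nhds] with s' h1 h2
    obtain ⟨_, hU', hT'⟩ := hη v _ h1
    obtain ⟨k', hk', f1, f2, _⟩ := hβd v _ hU'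
    obtain ⟨d', hd0', hd'⟩ := hτd s'
    obtain ⟨_, e0, e1⟩ := key s' d' hd' hd0' h2 _ hU' k' hk' hT' f1 f2
    exact ⟨by rw [e0]; ring, by rw [e1]; ring⟩
  rw [← hτs] at g3 g4 g5 g6
  have hC : HasDerivAt (fun s' => -(a (η v (τ s')))) (fderiv ℝ a u (w₁ u)) s := by
    have := (g5.comp s hd).neg
    rw [hdk] at this
    convert! this using 1
    field_simp
  have hD : HasDerivAt (fun s' => -(b (η v (τ s')))) (fderiv ℝ b u (w₁ u)) s := by
    have := (g6.comp s hd).neg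
    rw [hdk] at this
    convert! this using 1
    field_simp
  rw [geod_formula m α hα s _ _ _ _ (hαF s).ne' (by simp only [g3, g4]; linarith [hab u])
    (hnear.mono fun _ h => h.1) (hnear.mono fun _ h => h.2) hC hD]
  simp only [g3, g4, hαs]
  simp
  ring

/-- Let `Σ` be a surface in a BCV space `M³_{m,l}` whose unit normal
`ξ = b E₁ − a E₂` (`a² + b² = 1`) is everywhere orthogonal to `E₃`, with adapted
orthonormal frame `e₁ = a E₁ + b E₂`, `e₂ = E₃` (realised by domain fields `w₁`, `w₂`
with `dφ(wᵢ) = eᵢ`).  Then the second fundamental form satisfies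
`h(e₁,e₁) = −(a e₁(b) − b e₁(a) + 2m(ay − bx))`, `h(e₁,e₂) = l/2`, `h(e₂,e₂) = 0`,
and `e₂(a) = e₂(b) = 0`; consequently `Σ` is a Hopf cylinder over a curve whose geodesic
curvature is `κ_g = −(a e₁(b) − b e₁(a) + 2m(ay − bx))` in `(ℝ², h)`, with
`|A|² = κ_g² + l²/2` and mean curvature `H = κ_g/2`. -/
theorem hopf_cylinder_structure_in_BCV
    (m l : ℝ) (φ ξ e₁ e₂ : Pt 2 → Pt 3) (a b : Pt 2 → ℝ) (w₁ w₂ : Pt 2 → Pt 2)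
    (hφ : IsImmersion φ) (hdom : ∀ u, 0 < bcvF m (φ u))
    (hab : ∀ u, a u ^ 2 + b u ^ 2 = 1)
    (hasm : ContDiff ℝ (⊤ : ℕ∞) a) (hbsm : ContDiff ℝ (⊤ : ℕ∞) b)
    (he₁ : ∀ u, e₁ u = a u • bcvE m l 0 (φ u) + b u • bcvE m l 1 (φ u))
    (he₂ : ∀ u, e₂ u = bcvE m l 2 (φ u))
    (hξd : ∀ u, ξ u = b u • bcvE m l 0 (φ u) - a u • bcvE m l 1 (φ u))
    (hξ : IsUnitNormal (bcvMet m l) φ ξ)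
    (hw₁ : ∀ u, push φ u (w₁ u) = e₁ u) (hw₂ : ∀ u, push φ u (w₂ u) = e₂ u) :
    (∀ u, sffVec (bcvMet m l) φ ξ u (w₁ u) (w₁ u) =
        -(a u * fderiv ℝ b u (w₁ u) - b u * fderiv ℝ a u (w₁ u)
          + 2 * m * (a u * φ u 1 - b u * φ u 0))) ∧
    (∀ u, sffVec (bcvMet m l) φ ξ u (w₁ u) (w₂ u) = l / 2) ∧
    (∀ u, sffVec (bcvMet m l) φ ξ u (w₂ u) (w₂ u) = 0) ∧
    (∀ u, fderiv ℝ a u (w₂ u) = 0 ∧ fderiv ℝ b u (w₂ u) = 0) ∧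
    (∀ u, normA2 (bcvMet m l) φ ξ u =
      (a u * fderiv ℝ b u (w₁ u) - b u * fderiv ℝ a u (w₁ u)
          + 2 * m * (a u * φ u 1 - b u * φ u 0)) ^ 2 + l ^ 2 / 2) ∧
    (∀ u, meanCurv (bcvMet m l) φ ξ u =
      -(a u * fderiv ℝ b u (w₁ u) - b u * fderiv ℝ a u (w₁ u)
          + 2 * m * (a u * φ u 1 - b u * φ u 0)) / 2) ∧
    (∃ α : ℝ → Pt 2, ContDiff ℝ (⊤ : ℕ∞) α ∧
      (∀ s, gip (bcvBase m) (α s) (deriv α s) (deriv α s) = 1) ∧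
      ∀ u, ∃ s, α s 0 = φ u 0 ∧ α s 1 = φ u 1 ∧
        geodCurv m α s = -(a u * fderiv ℝ b u (w₁ u) - b u * fderiv ℝ a u (w₁ u)
          + 2 * m * (a u * φ u 1 - b u * φ u 0))) := by
  have P := part_one m l φ ξ e₁ e₂ a b w₁ w₂ hφ hdom hab hasm hbsm he₁ he₂ hξd hξ hw₁ hw₂
  refine ⟨fun u => (P u).1, fun u => (P u).2.1, fun u => (P u).2.2.1, fun u => (P u).2.2.2.1,
    fun u => (P u).2.2.2.2.1, fun u => (P u).2.2.2.2.2, ?_⟩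
  have q1 : ∀ u k, fderiv ℝ (fun q => φ q k) u (w₁ u) = e₁ u k := fun u k => congrFun (hw₁ u) k
  have q2 : ∀ u k, fderiv ℝ (fun q => φ q k) u (w₂ u) = e₂ u k := fun u k => congrFun (hw₂ u) k
  exact curve_part m (fun u => φ u 0) (fun u => φ u 1) (fun u => φ u 2) a b w₁ w₂
    (hφ.1 0) (hφ.1 1) (hφ.1 2) hasm hbsm hdom hab
    (fun u => by rw [q1, he₁]; simp [bcvE, bcvF]; ring)
    (fun u => by rw [q1, he₁]; simp [bcvE, bcvF]; ring)
    (fun u => by rw [q2, he₂]; simp [bcvE]) (fun u => by rw [q2, he₂]; simp [bcvE])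
    (fun u => by rw [q2, he₂]; simp [bcvE])
    (fun u => (P u).2.2.2.1.1) (fun u => (P u).2.2.2.1.2)
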